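/- arXiv:2510.06340 — 3 statements merged into one kernel-verified Lean document; each statement's English description precedes it below -/
import Mathlib

section
/- Equality of regularised relative entropies for i.i.d. versus arbitrarily varying convexified alternative hypotheses. Let ℋ = ℂ^d be a finite-dimensional Hilbert space, ℬ₁ ⊆ 𝒟(ℋ) a non-empty closed convex set of states, and 𝒜 = (𝒜_n)_n any sequence of convex sets 𝒜_n ⊆ 𝒟(ℋ^{⊗n}) each closed under the unitaries permuting the n tensor factors. Then D^∞(𝒜‖co(ℬ₁^{iid})) = D^∞(𝒜‖co(ℬ₁^{av})), i.e. liminf_{n→∞} (1/n) D(𝒜_n‖co(ℬ₁^{⊗n,iid})) = liminf_{n→∞} (1/n) D(𝒜_n‖co(ℬ₁^{⊗n,av})). -/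
open Filter MeasureTheory Topology
open scoped BigOperators Classical ComplexOrder

noncomputable section

namespace QSanov

/-- Matrices representing operators on the single-copy Hilbert space with orthonormal
basis indexed by `ι`. -/
abbrev MatC (ι : Type*) := Matrix ι ι ℂ

/-- Matrices representing operators on the `n`-fold tensor power Hilbert space. -/
abbrev MatN (ι : Type*) (n : ℕ) := Matrix (Fin n → ι) (Fin n → ι) ℂ

instance matMeasurableSpace (m n : Type*) : MeasurableSpace (Matrix m n ℂ) :=
  inferInstanceAs (MeasurableSpace (m → n → ℂ))

/-- A quantum state: a positive semidefinite matrix of trace one. -/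
def IsState {κ : Type*} [Fintype κ] (ρ : Matrix κ κ ℂ) : Prop :=
  ρ.PosSemidef ∧ ρ.trace = 1

/-- Loewner order: `A ≤ B` iff `B - A` is positive semidefinite. -/
def loewnerLE {κ : Type*} [Fintype κ] (A B : Matrix κ κ ℂ) : Prop :=
  (B - A).PosSemidef

/-- The `n`-fold tensor power `ρ^{⊗n}` of a single-copy matrix. -/
def tensorPow {ι : Type*} (ρ : MatC ι) (n : ℕ) : MatN ι n :=
  fun i j => ∏ k, ρ (i k) (j k)

/-- The tensor product `ρ₁ ⊗ ⋯ ⊗ ρ_n` of a family of single-copy matrices. -/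
def tensorProdFam {ι : Type*} {n : ℕ} (ρ : Fin n → MatC ι) : MatN ι n :=
  fun i j => ∏ k, ρ k (i k) (j k)

/-- The tensor product of an `n`-copy matrix and an `m`-copy matrix. -/
def tensorMul {ι : Type*} {n m : ℕ} (ρ : MatN ι n) (σ : MatN ι m) : MatN ι (n + m) :=
  fun i j => ρ (fun t => i (Fin.castAdd m t)) (fun t => j (Fin.castAdd m t)) *
    σ (fun t => i (Fin.natAdd n t)) (fun t => j (Fin.natAdd n t))

/-- Conjugation `U_π ρ U_π†` by the unitary permuting the `n` tensor factors. -/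
def permCopies {ι : Type*} {n : ℕ} (π : Equiv.Perm (Fin n)) (ρ : MatN ι n) : MatN ι n :=
  fun i j => ρ (i ∘ π) (j ∘ π)

/-- Matrix logarithm via functional calculus on the support (eigenvalue `0` is sent
to `0`, since `Real.log 0 = 0`). -/
def matLog {κ : Type*} [Fintype κ] [DecidableEq κ] (A : Matrix κ κ ℂ) : Matrix κ κ ℂ :=
  if hA : A.IsHermitian then
    (hA.eigenvectorUnitary : Matrix κ κ ℂ) *
      (Matrix.diagonal fun i => (Real.log (hA.eigenvalues i) : ℂ)) *
      (star (hA.eigenvectorUnitary : Matrix κ κ ℂ))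
  else 0

/-- Support inclusion `supp ρ ⊆ supp σ`, phrased as inclusion of ranges. -/
def suppLE {κ : Type*} [Fintype κ] [DecidableEq κ] (ρ σ : Matrix κ κ ℂ) : Prop :=
  LinearMap.range (Matrix.toLin' ρ) ≤ LinearMap.range (Matrix.toLin' σ)

/-- Umegaki relative entropy `D(ρ‖σ) = Tr[ρ (log ρ - log σ)]`, equal to `+∞` when
`supp ρ ⊄ supp σ`. -/
def relEnt {κ : Type*} [Fintype κ] [DecidableEq κ] (ρ σ : Matrix κ κ ℂ) : EReal :=
  if suppLE ρ σ then (((ρ * (matLog ρ - matLog σ)).trace.re : ℝ) : EReal) else ⊤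

/-- Relative entropy between two sets of states: `D(𝒜‖ℬ) = inf_{ρ∈𝒜, σ∈ℬ} D(ρ‖σ)`. -/
def relEntSet {κ : Type*} [Fintype κ] [DecidableEq κ] (A B : Set (Matrix κ κ ℂ)) : EReal :=
  ⨅ ρ ∈ A, ⨅ σ ∈ B, relEnt ρ σ

/-- The composite i.i.d. hypothesis `𝒻₁^{⊗n, iid}` built on the base set `F1`. -/
def iidSet {ι : Type*} (F1 : Set (MatC ι)) (n : ℕ) : Set (MatN ι n) :=
  {ρ | ∃ σ ∈ F1, ρ = tensorPow σ n}

/-- The arbitrarily varying hypothesis `𝒻₁^{⊗n, av}` built on the base set `F1`. -/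
def avSet {ι : Type*} (F1 : Set (MatC ι)) (n : ℕ) : Set (MatN ι n) :=
  {ρ | ∃ f : Fin n → MatC ι, (∀ p, f p ∈ F1) ∧ ρ = tensorProdFam f}

/-- Worst-case type II error probability `β_ε(A‖B)` for a threshold `ε` on the
worst-case type I error probability. -/
def typeII {κ : Type*} [Fintype κ] [DecidableEq κ] (A B : Set (Matrix κ κ ℂ)) (ε : ℝ) : ℝ :=
  sInf {b : ℝ | ∃ E : Matrix κ κ ℂ, E.PosSemidef ∧ (1 - E).PosSemidef ∧
    (∀ ρ ∈ A, (ρ * (1 - E)).trace.re ≤ ε) ∧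
    b = sSup {x : ℝ | ∃ σ ∈ B, x = (σ * E).trace.re}}

/-- `- log x`, with value `+∞` for `x ≤ 0`. -/
def negLog (x : ℝ) : EReal := if x ≤ 0 then ⊤ else ((-Real.log x : ℝ) : EReal)

/-- `(1/n : EReal)`. -/
def cFrac (n : ℕ) : EReal := (((n : ℝ)⁻¹ : ℝ) : EReal)

/-- The Stein exponent `Stein(𝒜‖ℬ) = lim_{ε→0⁺} liminf_n -(1/n) log β_ε(𝒜_n‖ℬ_n)`;
since the inner quantity is monotone nondecreasing in `ε`, the limit as `ε → 0⁺`
coincides with the infimum over `ε ∈ (0,1)`. -/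
def steinExponent {ι : Type*} [Fintype ι] [DecidableEq ι]
    (A B : ∀ n : ℕ, Set (MatN ι n)) : EReal :=
  ⨅ ε ∈ Set.Ioo (0 : ℝ) 1,
    Filter.liminf (fun n : ℕ => cFrac n * negLog (typeII (A n) (B n) ε)) Filter.atTop

/-- The mixture `∫ dμ(σ) σ^{⊗n}` of i.i.d. states along a measure `μ` on a set of
states `C` (Bochner integral, computed entrywise). -/
def iidMix {ι : Type*} {C : Set (MatC ι)} (μ : Measure ↥C) (n : ℕ) : MatN ι n :=
  fun i j => ∫ σ, (∏ k, (σ : MatC ι) (i k) (j k)) ∂μ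

/-- The `b`-th block of size `k` of an index of `ℋ^{⊗ mk}`. -/
def blockOf {ι : Type*} {m k : ℕ} (i : Fin (m * k) → ι) (b : Fin m) : Fin k → ι :=
  fun t => i (finProdFinEquiv (b, t))

/-- Replace the blocks in `S` of the index `i` by the values prescribed by `c`. -/
def mergeBlocks {ι : Type*} {m k : ℕ} (S : Finset (Fin m)) (c : Fin m → Fin k → ι)
    (i : Fin (m * k) → ι) : Fin (m * k) → ι :=
  fun p => if (finProdFinEquiv.symm p).1 ∈ S
    then c (finProdFinEquiv.symm p).1 (finProdFinEquiv.symm p).2 else i p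

/-- Entry `(i,j)` of the partial trace of `ρ` over the blocks in `S`
(the remaining blocks being evaluated at `i`, `j`). -/
def blockPartialTrace {ι : Type*} [Fintype ι] {m k : ℕ} (S : Finset (Fin m))
    (ρ : MatN ι (m * k)) (i j : Fin (m * k) → ι) : ℂ :=
  (((Fintype.card ι : ℂ) ^ (k * (m - S.card)))⁻¹) *
    ∑ c : Fin m → Fin k → ι, ρ (mergeBlocks S c i) (mergeBlocks S c j)

/-- The `m`-fold tensor power `(𝒩^δ_ω)^{⊗ m}` of the depolarising channel
`𝒩^δ_ω(X) = (1-δ) X + δ Tr[X] ω`, acting blockwise on blocks of `k` tensor factors. -/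
def blockDepolarize {ι : Type*} [Fintype ι] (δ : ℝ) {k : ℕ} (ω : MatN ι k) (m : ℕ)
    (ρ : MatN ι (m * k)) : MatN ι (m * k) :=
  fun i j => ∑ S : Finset (Fin m),
    (((1 - δ) ^ (m - S.card) * δ ^ S.card : ℝ) : ℂ) *
      ((∏ b ∈ S, ω (blockOf i b) (blockOf j b)) * blockPartialTrace S ρ i j)

/-- The `m`-fold tensor power of a `k`-copy matrix, as an `mk`-copy matrix. -/
def powBlocks {ι : Type*} {k : ℕ} (ρ : MatN ι k) (m : ℕ) : MatN ι (m * k) :=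
  fun i j => ∏ b : Fin m, ρ (blockOf i b) (blockOf j b)

/-- `Tr_{n+1,…,n+k}[ρ (𝟙^{⊗n} ⊗ F)]`, the filtered reduction of an `(n+k)`-copy matrix. -/
def condReduce {ι : Type*} [Fintype ι] {n k : ℕ} (ρ : MatN ι (n + k)) (F : MatN ι k) :
    MatN ι n :=
  fun i j => ∑ a : Fin k → ι, ∑ b : Fin k → ι,
    ρ (Fin.append i a) (Fin.append j b) * F b a

/-- Partial trace over the `k`-th tensor factor. -/
def traceOutAt {ι : Type*} [Fintype ι] {n : ℕ} (k : Fin (n + 1)) (σ : MatN ι (n + 1)) :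
    MatN ι n :=
  fun i j => ∑ a : ι, σ (k.insertNth a i) (k.insertNth a j)

/-- Insert the single-copy state `τ` at position `k` into an `n`-copy matrix. -/
def insertState {ι : Type*} {n : ℕ} (k : Fin (n + 1)) (τ : MatC ι) (σ : MatN ι n) :
    MatN ι (n + 1) :=
  fun i j => τ (i k) (j k) *
    σ (fun t => i (k.succAbove t)) (fun t => j (k.succAbove t))

/-- Product of a state on `A^n` and a state on `B^n`, viewed as a state on
`(ℋ_A ⊗ ℋ_B)^{⊗ n}` (reordering tensor factors implicitly). -/
def prodStateAB {ιA ιB : Type*} {n : ℕ} (α : Matrix (Fin n → ιA) (Fin n → ιA) ℂ)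
    (β : Matrix (Fin n → ιB) (Fin n → ιB) ℂ) : MatN (ιA × ιB) n :=
  fun i j => α (fun k => (i k).1) (fun k => (j k).1) * β (fun k => (i k).2) (fun k => (j k).2)


/-- The set `𝒮_{A^n:B^n}` of separable states across the cut `A^n : B^n`. -/
def sepSet (ιA ιB : Type*) [Fintype ιA] [Fintype ιB] (n : ℕ) : Set (MatN (ιA × ιB) n) :=
  convexHull ℝ {ρ | ∃ α β, IsState α ∧ IsState β ∧ ρ = prodStateAB α β}

/-- Classical relative entropy of two finitely supported output distributions. -/
def clRelEnt {m : ℕ} (P Q : Fin m → ℝ) : EReal :=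
  ∑ x, (if P x = 0 then (0 : EReal) else if Q x = 0 then (⊤ : EReal)
    else ((P x * Real.log (P x / Q x) : ℝ) : EReal))

/-- Measured relative entropy: supremum over all finite POVMs of the classical
relative entropy of the induced outcome distributions. -/
def measuredRelEnt {κ : Type*} [Fintype κ] [DecidableEq κ] (ρ σ : Matrix κ κ ℂ) : EReal :=
  ⨆ (m : ℕ) (E : Fin m → Matrix κ κ ℂ) (_ : ∀ x, (E x).PosSemidef) (_ : ∑ x, E x = 1),
    clRelEnt (fun x => (ρ * E x).trace.re) (fun x => (σ * E x).trace.re)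


/-- Axiom Q.I: there is a full-support free state `τ ∈ 𝒜₁` such that every `𝒜_{mk}`
is stable under blockwise depolarising towards `τ^{⊗k}`. -/
def AxiomQI {ι : Type*} [Fintype ι] [DecidableEq ι] (A : ∀ n : ℕ, Set (MatN ι n)) : Prop :=
  ∃ τ : MatC ι, tensorPow τ 1 ∈ A 1 ∧
    ∀ m k : ℕ, 1 ≤ m → 1 ≤ k → ∀ ρ ∈ A (m * k),
      suppLE ρ (tensorPow τ (m * k)) ∧
      ∀ δ ∈ Set.Icc (0 : ℝ) 1, blockDepolarize δ (tensorPow τ k) m ρ ∈ A (m * k)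

/-- Axiom Q.II: closedness under tensor powers. -/
def AxiomQII {ι : Type*} (A : ∀ n : ℕ, Set (MatN ι n)) : Prop :=
  ∀ m k : ℕ, 1 ≤ m → 1 ≤ k → ∀ ρ ∈ A k, powBlocks ρ m ∈ A (m * k)

/-- Axiom Q.III: closedness under permutations of the tensor factors. -/
def AxiomQIII {ι : Type*} (A : ∀ n : ℕ, Set (MatN ι n)) : Prop :=
  ∀ n : ℕ, ∀ ρ ∈ A n, ∀ π : Equiv.Perm (Fin n), permCopies π ρ ∈ A n

/-- Axiom Q.IV: filtering by Hermitian operators in a neighbourhood of the identity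
is completely `cone(𝒜)`-preserving. -/
def AxiomQIV {ι : Type*} [Fintype ι] [DecidableEq ι] (A : ∀ n : ℕ, Set (MatN ι n)) : Prop :=
  ∀ k : ℕ, 1 ≤ k →
    ∃ V : Set (MatN ι k), V ∈ nhds (1 : MatN ι k) ∧
      ∀ F ∈ V, F.IsHermitian → ∀ n : ℕ, 1 ≤ n → ∀ ρ ∈ A (n + k),
        ∃ (lam : ℝ) (ω : MatN ι n), 0 ≤ lam ∧ ω ∈ A n ∧ condReduce ρ F = (lam : ℂ) • ω

lemma hasDerivAt_log_ratio {p q : ℝ} (hp : 0 < p) (hq : 0 < q) {s : ℝ} (hs : 0 ≤ s) :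
    HasDerivAt (fun s => p * (Real.log (q + s * p) - Real.log (1 + s)))
      (p ^ 2 / (q + s * p) - p / (1 + s)) s := by
  have h1 : 0 < q + s * p := by positivity
  have h2 : 0 < 1 + s := by positivity
  have hd1 : HasDerivAt (fun s => q + s * p) p s := by
    simpa using ((hasDerivAt_id s).mul_const p).const_add q
  have hd2 : HasDerivAt (fun s : ℝ => 1 + s) 1 s := by
    simpa using (hasDerivAt_id s).const_add 1
  refine (((hd1.log h1.ne').sub (hd2.log h2.ne')).const_mul p).congr_deriv ?_
  ring

lemma tendsto_log_ratio {p : ℝ} (hp : 0 < p) {q : ℝ} (hq : 0 < q) :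
    Tendsto (fun s => p * (Real.log (q + s * p) - Real.log (1 + s))) atTop
      (𝓝 (p * Real.log p)) := by
  have hlim : Tendsto (fun s : ℝ => p + (q - p) / (1 + s)) atTop (𝓝 p) := by
    simpa using (tendsto_const_nhds (x := p)).add
      (Tendsto.div_atTop (tendsto_const_nhds (x := q - p))
        (tendsto_atTop_add_const_left _ (1 : ℝ) tendsto_id))
  refine ((hlim.log hp.ne').const_mul p).congr' ?_
  filter_upwards [eventually_ge_atTop (0 : ℝ)] with s hs
  have h1 : 0 < q + s * p := by positivity
  have h2 : 0 < 1 + s := by positivity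
  rw [← Real.log_div h1.ne' h2.ne']
  congr 2
  field_simp
  ring

lemma integrableOn_and_integral_log_ratio {p q : ℝ} (hp : 0 < p) (hq : 0 < q) :
    IntegrableOn (fun s => p ^ 2 / (q + s * p) - p / (1 + s)) (Set.Ioi 0) ∧
      ∫ s in Set.Ioi (0 : ℝ), (p ^ 2 / (q + s * p) - p / (1 + s)) =
        p * (Real.log p - Real.log q) := by
  have hd := fun s (hs : s ∈ Set.Ici (0 : ℝ)) => hasDerivAt_log_ratio hp hq hs
  have heq : ∀ s ∈ Set.Ioi (0 : ℝ),
      p ^ 2 / (q + s * p) - p / (1 + s) = p / ((q + s * p) * (1 + s)) * (p - q) := by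
    intro s hs
    have hs : 0 < s := hs
    have h1 : 0 < q + s * p := by positivity
    have h2 : 0 < 1 + s := by positivity
    field_simp
    ring
  have hnn : ∀ s ∈ Set.Ioi (0 : ℝ), 0 ≤ p / ((q + s * p) * (1 + s)) := by
    intro s hs
    have hs : 0 < s := hs
    positivity
  have hint : IntegrableOn (fun s => p ^ 2 / (q + s * p) - p / (1 + s)) (Set.Ioi 0) := by
    rcases le_total q p with h | h
    · refine integrableOn_Ioi_deriv_of_nonneg' hd (fun s hs => ?_) (tendsto_log_ratio hp hq)
      rw [heq s hs]
      exact mul_nonneg (hnn s hs) (sub_nonneg.2 h)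
    · refine integrableOn_Ioi_deriv_of_nonpos' hd (fun s hs => ?_) (tendsto_log_ratio hp hq)
      rw [heq s hs]
      exact mul_nonpos_of_nonneg_of_nonpos (hnn s hs) (sub_nonpos.2 h)
  refine ⟨hint, ?_⟩
  rw [integral_Ioi_of_hasDerivAt_of_tendsto' hd hint (tendsto_log_ratio hp hq)]
  simp [mul_sub]

section Spectral

open Matrix

variable {κ : Type*} [Fintype κ] [DecidableEq κ]

lemma isHermitian_eq_conj {A : Matrix κ κ ℂ} (hA : A.IsHermitian) :
    A = (hA.eigenvectorUnitary : Matrix κ κ ℂ) *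
      diagonal (fun i => ((hA.eigenvalues i : ℝ) : ℂ)) *
      (hA.eigenvectorUnitary : Matrix κ κ ℂ)ᴴ := by
  conv_lhs => rw [hA.spectral_theorem]
  rfl

lemma trace_conj_diagonal_mul (U V : Matrix κ κ ℂ) (a b : κ → ℝ) :
    ((U * diagonal (fun i => ((a i : ℝ) : ℂ)) * Uᴴ) *
      (V * diagonal (fun i => ((b i : ℝ) : ℂ)) * Vᴴ)).trace.re =
      ∑ i, ∑ j, Complex.normSq ((Uᴴ * V) i j) * (a i * b j) := by
  set W := Uᴴ * V with hW
  have hW' : Vᴴ * U = Wᴴ := by simp [hW]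
  have : ((U * diagonal (fun i => ((a i : ℝ) : ℂ)) * Uᴴ) *
      (V * diagonal (fun i => ((b i : ℝ) : ℂ)) * Vᴴ)).trace =
      (diagonal (fun i => ((a i : ℝ) : ℂ)) * W *
        (diagonal (fun i => ((b i : ℝ) : ℂ)) * Wᴴ)).trace := by
    rw [← hW', hW]
    simp only [Matrix.mul_assoc]
    rw [Matrix.trace_mul_comm]
    simp only [Matrix.mul_assoc]
  rw [this]
  simp only [Matrix.trace, Matrix.diag,
    Matrix.mul_apply (M := diagonal (fun i => ((a i : ℝ) : ℂ)) * W), diagonal_mul,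
    conjTranspose_apply, Complex.re_sum]
  refine Finset.sum_congr rfl fun i _ => Finset.sum_congr rfl fun j _ => ?_
  simp [Complex.normSq_apply]
  ring

/-- A quadratic functional of `Y`, whose supremum over `Y` integrates (over `s`, up to
normalisation) to the relative entropy of `ρ` and `l • σ`. -/
def quadFun (s l : ℝ) (ρ σ Y : Matrix κ κ ℂ) : ℝ :=
  2 * (ρ * Y).trace.re - l * (Yᴴ * σ * Y).trace.re - s * (Y * ρ * Yᴴ).trace.re

lemma quadFun_conj (s l : ℝ) {U V : Matrix κ κ ℂ} (hU : Uᴴ * U = 1) (hV : Vᴴ * V = 1)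
    (y : Matrix κ κ ℂ) (p q : κ → ℝ) :
    quadFun s l (U * diagonal (fun i => ((p i : ℝ) : ℂ)) * Uᴴ)
      (V * diagonal (fun i => ((q i : ℝ) : ℂ)) * Vᴴ) (V * y * Uᴴ) =
      ∑ i, ∑ j, (2 * p i * ((Uᴴ * V) i j * y j i).re -
        (l * q j + s * p i) * Complex.normSq (y j i)) := by
  set P := diagonal (fun i => ((p i : ℝ) : ℂ)) with hP
  set Q := diagonal (fun i => ((q i : ℝ) : ℂ)) with hQ
  have hU' : ∀ M : Matrix κ κ ℂ, Uᴴ * (U * M) = M := fun M => by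
    rw [← Matrix.mul_assoc, hU, Matrix.one_mul]
  have hV' : ∀ M : Matrix κ κ ℂ, Vᴴ * (V * M) = M := fun M => by
    rw [← Matrix.mul_assoc, hV, Matrix.one_mul]
  have h1 : ((U * P * Uᴴ) * (V * y * Uᴴ)).trace = (P * (Uᴴ * V * y)).trace := by
    simp only [Matrix.mul_assoc]
    rw [Matrix.trace_mul_comm]
    simp only [Matrix.mul_assoc, hU, Matrix.mul_one]
  have h2 : ((V * y * Uᴴ)ᴴ * (V * Q * Vᴴ) * (V * y * Uᴴ)).trace = (yᴴ * (Q * y)).trace := by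
    simp only [conjTranspose_mul, conjTranspose_conjTranspose, Matrix.mul_assoc, hV']
    rw [Matrix.trace_mul_comm]
    simp only [Matrix.mul_assoc, hU, Matrix.mul_one]
  have h3 : ((V * y * Uᴴ) * (U * P * Uᴴ) * (V * y * Uᴴ)ᴴ).trace = (y * P * yᴴ).trace := by
    simp only [conjTranspose_mul, conjTranspose_conjTranspose, Matrix.mul_assoc, hU']
    rw [Matrix.trace_mul_comm]
    simp only [Matrix.mul_assoc, hV, Matrix.mul_one]
  rw [quadFun, h1, h2, h3, Matrix.trace_mul_comm (y * P)]
  simp only [Matrix.trace, Matrix.diag, Matrix.mul_apply (M := Uᴴ * V),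
    Matrix.mul_apply (M := yᴴ), hP, hQ, diagonal_mul, mul_diagonal, Complex.re_sum,
    conjTranspose_apply, Finset.mul_sum, ← Finset.sum_sub_distrib]
  refine Finset.sum_congr rfl fun i _ => Finset.sum_congr rfl fun j _ => ?_
  simp [Complex.normSq_apply]
  ring

/-- Maximal value of `quadFun` in terms of the spectral data of its arguments. -/
def quadSup (s l : ℝ) (W : Matrix κ κ ℂ) (p q : κ → ℝ) : ℝ :=
  ∑ i, ∑ j, Complex.normSq (W i j) * (p i ^ 2 / (l * q j + s * p i))

omit [Fintype κ] [DecidableEq κ] in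
lemma quadratic_le (w y : ℂ) {p q : ℝ} (hp : 0 ≤ p) (hq : 0 ≤ q) {s : ℝ} (hs : 0 < s) :
    2 * p * (w * y).re - (q + s * p) * Complex.normSq y ≤
      Complex.normSq w * (p ^ 2 / (q + s * p)) := by
  rcases hp.eq_or_lt with rfl | hp
  · have := mul_nonneg hq (Complex.normSq_nonneg y)
    simp
    linarith
  · have hc : 0 < q + s * p := by positivity
    rw [mul_div_assoc', le_div_iff₀ hc]
    have h := Complex.normSq_nonneg ((p : ℂ) * w - ((q + s * p : ℝ) : ℂ) * starRingEnd ℂ y)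
    simp only [Complex.normSq_apply, Complex.sub_re, Complex.sub_im, Complex.mul_re,
      Complex.mul_im, Complex.ofReal_re, Complex.ofReal_im, Complex.conj_re, Complex.conj_im] at h ⊢
    nlinarith

lemma quadFun_le_quadSup {s l : ℝ} (hs : 0 < s) (hl : 0 < l) {U V : Matrix κ κ ℂ}
    (hU : Uᴴ * U = 1) (hV : Vᴴ * V = 1) (hV2 : V * Vᴴ = 1)
    {p q : κ → ℝ} (hp : ∀ i, 0 ≤ p i) (hq : ∀ i, 0 ≤ q i) (Y : Matrix κ κ ℂ) :
    quadFun s l (U * diagonal (fun i => ((p i : ℝ) : ℂ)) * Uᴴ)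
      (V * diagonal (fun i => ((q i : ℝ) : ℂ)) * Vᴴ) Y ≤ quadSup s l (Uᴴ * V) p q := by
  have hU2 : U * Uᴴ = 1 := mul_eq_one_comm.1 hU
  have hY : Y = V * (Vᴴ * Y * U) * Uᴴ := by
    rw [Matrix.mul_assoc, Matrix.mul_assoc _ U, hU2, Matrix.mul_one, ← Matrix.mul_assoc, hV2,
      Matrix.one_mul]
  rw [hY, quadFun_conj s l hU hV]
  exact Finset.sum_le_sum fun i _ => Finset.sum_le_sum fun j _ =>
    quadratic_le _ _ (hp i) (mul_nonneg hl.le (hq j)) hs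

lemma exists_quadFun_eq_quadSup {s l : ℝ} (hs : 0 < s) (hl : 0 < l) {U V : Matrix κ κ ℂ}
    (hU : Uᴴ * U = 1) (hV : Vᴴ * V = 1) {p q : κ → ℝ} (hp : ∀ i, 0 ≤ p i) (hq : ∀ i, 0 ≤ q i) :
    ∃ Y, quadFun s l (U * diagonal (fun i => ((p i : ℝ) : ℂ)) * Uᴴ)
      (V * diagonal (fun i => ((q i : ℝ) : ℂ)) * Vᴴ) Y = quadSup s l (Uᴴ * V) p q := by
  refine ⟨V * Matrix.of (fun j i => ((p i / (l * q j + s * p i) : ℝ) : ℂ) *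
    starRingEnd ℂ ((Uᴴ * V) i j)) * Uᴴ, ?_⟩
  rw [quadFun_conj s l hU hV]
  refine Finset.sum_congr rfl fun i _ => Finset.sum_congr rfl fun j _ => ?_
  simp only [of_apply]
  generalize (Uᴴ * V) i j = w
  rcases (hp i).eq_or_lt with h | h
  · simp [← h]
  · have hc : 0 < l * q j + s * p i := by
      have := mul_nonneg hl.le (hq j)
      positivity
    simp only [Complex.normSq_apply, Complex.mul_re, Complex.mul_im, Complex.ofReal_re,
      Complex.ofReal_im, Complex.conj_re, Complex.conj_im]
    generalize l * q j + s * p i = c at hc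
    field_simp
    ring

lemma suppLE_iff_exists_mul {ρ σ : Matrix κ κ ℂ} : suppLE ρ σ ↔ ∃ C, ρ = σ * C := by
  constructor
  · intro h
    have h' : ∀ j, ∃ c, σ *ᵥ c = ρ.col j := fun j => by
      have : toLin' ρ (Pi.single j 1) ∈ LinearMap.range (toLin' σ) := h ⟨_, rfl⟩
      simpa using this
    choose c hc using h'
    refine ⟨(Matrix.of c)ᵀ, ?_⟩
    ext i j
    exact (congrFun (hc j) i).symm
  · rintro ⟨C, rfl⟩
    rw [suppLE, toLin'_mul]
    exact LinearMap.range_comp_le_range _ _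

lemma suppLE_iff_ker {ρ σ : Matrix κ κ ℂ} (hρ : ρ.IsHermitian) (hσ : σ.IsHermitian) :
    suppLE ρ σ ↔ ∀ x, σ *ᵥ x = 0 → ρ *ᵥ x = 0 := by
  rw [suppLE_iff_exists_mul]
  constructor
  · rintro ⟨C, hC⟩ x hx
    rw [← hρ.eq, hC, conjTranspose_mul, hσ.eq, ← mulVec_mulVec, hx, mulVec_zero]
  · intro h
    set V := (hσ.eigenvectorUnitary : Matrix κ κ ℂ) with hV
    set q := hσ.eigenvalues with hq
    have hV1 : Vᴴ * V = 1 := Unitary.coe_star_mul_self hσ.eigenvectorUnitary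
    have hV2 : V * Vᴴ = 1 := Unitary.coe_mul_star_self hσ.eigenvectorUnitary
    have hσV : σ * V = V * diagonal (fun i => ((q i : ℝ) : ℂ)) := by
      conv_lhs => rw [isHermitian_eq_conj hσ]
      rw [Matrix.mul_assoc, hV1, Matrix.mul_one]
    have hz : ∀ i j, q j = 0 → (ρ * V) i j = 0 := by
      intro i j hj
      have : σ *ᵥ (V.col j) = 0 := by
        ext k
        have := congrFun (congrFun hσV k) j
        rw [mul_diagonal, hj, Complex.ofReal_zero, mul_zero] at this
        exact this
      exact congrFun (h _ this) i
    have key : ρ * V * diagonal (fun i => (((q i)⁻¹ : ℝ) : ℂ)) *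
        diagonal (fun i => ((q i : ℝ) : ℂ)) = ρ * V := by
      ext i j
      rw [mul_diagonal, mul_diagonal]
      by_cases hj : q j = 0
      · simp [hz i j hj]
      · rw [mul_assoc, ← Complex.ofReal_mul, inv_mul_cancel₀ hj]
        simp
    have hρ' : ρ = ρ * V * diagonal (fun i => (((q i)⁻¹ : ℝ) : ℂ)) * Vᴴ * σ := by
      conv_rhs => rw [isHermitian_eq_conj hσ]
      rw [Matrix.mul_assoc V, Matrix.mul_assoc (ρ * V * _), ← Matrix.mul_assoc Vᴴ, hV1,
        Matrix.one_mul, ← Matrix.mul_assoc, key, Matrix.mul_assoc, hV2, Matrix.mul_one]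
    refine ⟨(ρ * V * diagonal (fun i => (((q i)⁻¹ : ℝ) : ℂ)) * Vᴴ)ᴴ, ?_⟩
    conv_lhs => rw [← hρ.eq, hρ', conjTranspose_mul, hσ.eq]

lemma sum_normSq_mul_eq_trace {U V : Matrix κ κ ℂ} (hV : V * Vᴴ = 1) (p : κ → ℝ) :
    ∑ i, ∑ j, Complex.normSq ((Uᴴ * V) i j) * p i =
      (U * diagonal (fun i => ((p i : ℝ) : ℂ)) * Uᴴ).trace.re := by
  have h := trace_conj_diagonal_mul U V p (fun _ => 1)
  simpa [hV] using h.symm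

lemma trace_mul_matLog_sub {ρ σ : Matrix κ κ ℂ} (hρ : ρ.IsHermitian) (hσ : σ.IsHermitian) :
    (ρ * (matLog ρ - matLog σ)).trace.re =
      ∑ i, ∑ j, Complex.normSq
        (((hρ.eigenvectorUnitary : Matrix κ κ ℂ)ᴴ * (hσ.eigenvectorUnitary : Matrix κ κ ℂ)) i j) *
        (hρ.eigenvalues i * (Real.log (hρ.eigenvalues i) - Real.log (hσ.eigenvalues j))) := by
  set U := (hρ.eigenvectorUnitary : Matrix κ κ ℂ) with hU
  set V := (hσ.eigenvectorUnitary : Matrix κ κ ℂ) with hV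
  have hU1 : Uᴴ * U = 1 := Unitary.coe_star_mul_self hρ.eigenvectorUnitary
  have hV2 : V * Vᴴ = 1 := Unitary.coe_mul_star_self hσ.eigenvectorUnitary
  have hlρ : matLog ρ = U * diagonal (fun i => ((Real.log (hρ.eigenvalues i) : ℝ) : ℂ)) * Uᴴ := by
    rw [matLog, dif_pos hρ]
    rfl
  have hlσ : matLog σ = V * diagonal (fun i => ((Real.log (hσ.eigenvalues i) : ℝ) : ℂ)) * Vᴴ := by
    rw [matLog, dif_pos hσ]
    rfl
  have h1 : (ρ * matLog ρ).trace.re =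
      ∑ i, ∑ j, Complex.normSq ((Uᴴ * V) i j) *
        (hρ.eigenvalues i * Real.log (hρ.eigenvalues i)) := by
    have h := trace_conj_diagonal_mul U U hρ.eigenvalues fun i => Real.log (hρ.eigenvalues i)
    rw [← isHermitian_eq_conj hρ, ← hlρ, hU1] at h
    rw [h, sum_normSq_mul_eq_trace hV2 (fun i => hρ.eigenvalues i * Real.log (hρ.eigenvalues i)),
      Matrix.trace_mul_comm, ← Matrix.mul_assoc, hU1, Matrix.one_mul, trace_diagonal,
      Complex.re_sum]
    refine Finset.sum_congr rfl fun i _ => ?_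
    rw [Finset.sum_eq_single i] <;> simp +contextual [eq_comm]
  have h2 : (ρ * matLog σ).trace.re =
      ∑ i, ∑ j, Complex.normSq ((Uᴴ * V) i j) *
        (hρ.eigenvalues i * Real.log (hσ.eigenvalues j)) := by
    have h := trace_conj_diagonal_mul U V hρ.eigenvalues fun i => Real.log (hσ.eigenvalues i)
    rwa [← isHermitian_eq_conj hρ, ← hlσ] at h
  rw [Matrix.mul_sub, trace_sub, Complex.sub_re, h1, h2, ← Finset.sum_sub_distrib]
  refine Finset.sum_congr rfl fun i _ => ?_
  rw [← Finset.sum_sub_distrib]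
  exact Finset.sum_congr rfl fun j _ => by ring

lemma integral_quadSup {ρ σ : Matrix κ κ ℂ} (hρ : ρ.PosSemidef) (hσ : σ.PosSemidef)
    (h : suppLE ρ σ) {l : ℝ} (hl : 0 < l) :
    IntegrableOn (fun s => quadSup s l ((hρ.1.eigenvectorUnitary : Matrix κ κ ℂ)ᴴ *
        (hσ.1.eigenvectorUnitary : Matrix κ κ ℂ)) hρ.1.eigenvalues hσ.1.eigenvalues -
        ρ.trace.re / (1 + s)) (Set.Ioi 0) ∧
      ∫ s in Set.Ioi (0 : ℝ), (quadSup s l ((hρ.1.eigenvectorUnitary : Matrix κ κ ℂ)ᴴ *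
        (hσ.1.eigenvectorUnitary : Matrix κ κ ℂ)) hρ.1.eigenvalues hσ.1.eigenvalues -
        ρ.trace.re / (1 + s)) =
      (ρ * (matLog ρ - matLog σ)).trace.re - Real.log l * ρ.trace.re := by
  rw [trace_mul_matLog_sub hρ.1 hσ.1]
  have hp := hρ.eigenvalues_nonneg
  have hq := hσ.eigenvalues_nonneg
  have hρU := isHermitian_eq_conj hρ.1
  have hσV := isHermitian_eq_conj hσ.1
  have hU1 : (hρ.1.eigenvectorUnitary : Matrix κ κ ℂ)ᴴ * hρ.1.eigenvectorUnitary = 1 :=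
    Unitary.coe_star_mul_self hρ.1.eigenvectorUnitary
  have hV1 : (hσ.1.eigenvectorUnitary : Matrix κ κ ℂ)ᴴ * hσ.1.eigenvectorUnitary = 1 :=
    Unitary.coe_star_mul_self hσ.1.eigenvectorUnitary
  have hV2 : (hσ.1.eigenvectorUnitary : Matrix κ κ ℂ) * (hσ.1.eigenvectorUnitary)ᴴ = 1 :=
    Unitary.coe_mul_star_self hσ.1.eigenvectorUnitary
  generalize hρ.1.eigenvalues = p at *
  generalize hσ.1.eigenvalues = q at *
  generalize (hρ.1.eigenvectorUnitary : Matrix κ κ ℂ) = U at *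
  generalize (hσ.1.eigenvectorUnitary : Matrix κ κ ℂ) = V at *
  have htr := sum_normSq_mul_eq_trace (U := U) hV2 p
  rw [← hρU] at htr
  have hzero : ∀ i j, q j = 0 → p i ≠ 0 → Complex.normSq ((Uᴴ * V) i j) = 0 := by
    intro i j hj hi
    obtain ⟨C, hC⟩ := suppLE_iff_exists_mul.1 h
    have h1 : ρ * V = Cᴴ * V * diagonal (fun i => ((q i : ℝ) : ℂ)) := by
      rw [← hρ.1.eq, hC, conjTranspose_mul, hσ.1.eq, Matrix.mul_assoc, Matrix.mul_assoc]
      conv_lhs => rw [hσV]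
      rw [Matrix.mul_assoc, hV1, Matrix.mul_one]
    have h2 : Uᴴ * (ρ * V) = diagonal (fun i => ((p i : ℝ) : ℂ)) * (Uᴴ * V) := by
      conv_lhs => rw [hρU]
      simp only [← Matrix.mul_assoc]
      rw [hU1, Matrix.one_mul]
    rw [h1, ← Matrix.mul_assoc] at h2
    have h3 := congrFun (congrFun h2 i) j
    rw [mul_diagonal, diagonal_mul, hj] at h3
    simpa [hi] using h3.symm
  have hterm : ∀ i j,
      IntegrableOn (fun s => Complex.normSq ((Uᴴ * V) i j) *
        (p i ^ 2 / (l * q j + s * p i) - p i / (1 + s))) (Set.Ioi 0) ∧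
      ∫ s in Set.Ioi (0 : ℝ), Complex.normSq ((Uᴴ * V) i j) *
        (p i ^ 2 / (l * q j + s * p i) - p i / (1 + s)) =
      Complex.normSq ((Uᴴ * V) i j) * (p i * (Real.log (p i) - Real.log (q j))) -
        Real.log l * (Complex.normSq ((Uᴴ * V) i j) * p i) := by
    intro i j
    rcases (hp i).eq_or_lt with hi | hi
    · simp [← hi]
    rcases (hq j).eq_or_lt with hj | hj
    · simp [hzero i j hj.symm hi.ne']
    obtain ⟨h1, h2⟩ := integrableOn_and_integral_log_ratio hi (mul_pos hl hj)
    refine ⟨h1.const_mul _, ?_⟩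
    rw [integral_const_mul, h2, Real.log_mul hl.ne' hj.ne']
    ring
  have hfun : (fun s => quadSup s l (Uᴴ * V) p q - ρ.trace.re / (1 + s)) =
      fun s => ∑ i, ∑ j, Complex.normSq ((Uᴴ * V) i j) *
        (p i ^ 2 / (l * q j + s * p i) - p i / (1 + s)) := by
    funext s
    rw [quadSup, ← htr, Finset.sum_div, ← Finset.sum_sub_distrib]
    refine Finset.sum_congr rfl fun i _ => ?_
    rw [Finset.sum_div, ← Finset.sum_sub_distrib]
    exact Finset.sum_congr rfl fun j _ => by ring
  rw [hfun]
  refine ⟨integrable_finsetSum _ fun i _ => integrable_finsetSum _ fun j _ => (hterm i j).1, ?_⟩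
  rw [integral_finsetSum _ fun i _ => integrable_finsetSum _ fun j _ => (hterm i j).1]
  simp_rw [integral_finsetSum _ fun j _ => (hterm _ j).1, fun i j => (hterm i j).2]
  simp only [Finset.sum_sub_distrib, ← Finset.mul_sum, htr]

lemma trace_mul_matLog_sub_le {ρ σ ρ' τ : Matrix κ κ ℂ} (hρ : ρ.PosSemidef) (hσ : σ.PosSemidef)
    (hρ' : ρ'.PosSemidef) (hτ : τ.PosSemidef) (h : suppLE ρ σ) (h' : suppLE ρ' τ)
    (htr : ρ'.trace.re = ρ.trace.re) {l : ℝ} (hl : 0 < l)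
    (hquad : ∀ s > 0, ∀ Y, ∃ Z, quadFun s l ρ' τ Y ≤ quadFun s 1 ρ σ Z) :
    (ρ' * (matLog ρ' - matLog τ)).trace.re ≤
      (ρ * (matLog ρ - matLog σ)).trace.re + Real.log l * ρ.trace.re := by
  obtain ⟨hi, he⟩ := integral_quadSup hρ hσ h one_pos
  obtain ⟨hi', he'⟩ := integral_quadSup hρ' hτ h' hl
  have key := setIntegral_mono_on hi' hi measurableSet_Ioi fun s hs => by
    obtain ⟨Y, hY⟩ := exists_quadFun_eq_quadSup (s := s) hs hl
      (Unitary.coe_star_mul_self hρ'.1.eigenvectorUnitary)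
      (Unitary.coe_star_mul_self hτ.1.eigenvectorUnitary)
      hρ'.eigenvalues_nonneg hτ.eigenvalues_nonneg
    obtain ⟨Z, hZ⟩ := hquad s hs Y
    have hle := quadFun_le_quadSup (s := s) hs one_pos
      (Unitary.coe_star_mul_self hρ.1.eigenvectorUnitary)
      (Unitary.coe_star_mul_self hσ.1.eigenvectorUnitary)
      (Unitary.coe_mul_star_self hσ.1.eigenvectorUnitary)
      hρ.eigenvalues_nonneg hσ.eigenvalues_nonneg Z
    rw [← isHermitian_eq_conj hρ'.1, ← isHermitian_eq_conj hτ.1] at hY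
    rw [← isHermitian_eq_conj hρ.1, ← isHermitian_eq_conj hσ.1] at hle
    rw [htr]
    exact sub_le_sub_right (hY ▸ hZ.trans hle) _
  rw [he, he', Real.log_one, htr] at key
  linarith

end Spectral

section Averaging

open Matrix

variable {κ : Type*} [Fintype κ] [DecidableEq κ]

omit [DecidableEq κ] in
lemma trace_submatrix_equiv_self (A : Matrix κ κ ℂ) (e : κ ≃ κ) :
    (A.submatrix e e).trace = A.trace :=
  Equiv.sum_comp e fun i => A i i

omit [DecidableEq κ] in
lemma quadFun_submatrix (s l : ℝ) (ρ σ Y : Matrix κ κ ℂ) (e : κ ≃ κ) :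
    quadFun s l (ρ.submatrix e e) (σ.submatrix e e) (Y.submatrix e e) = quadFun s l ρ σ Y := by
  simp only [quadFun, conjTranspose_submatrix, submatrix_mul_equiv, trace_submatrix_equiv_self]

omit [DecidableEq κ] in
lemma quadFun_average {P : Type*} [Fintype P] (s l c : ℝ) (R S : P → Matrix κ κ ℂ)
    (Y : Matrix κ κ ℂ) :
    quadFun s l (c • ∑ p, R p) (c • ∑ p, S p) Y = c * ∑ p, quadFun s l (R p) (S p) Y := by
  simp only [quadFun, Matrix.smul_mul, Matrix.mul_smul, Matrix.sum_mul, Matrix.mul_sum,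
    trace_smul, trace_sum, Complex.real_smul, Complex.re_ofReal_mul, Complex.re_sum,
    Finset.sum_sub_distrib]
  simp only [← Finset.mul_sum]
  ring

omit [DecidableEq κ] in
lemma quadFun_le_of_posSemidef_sub {s l : ℝ} {ρ σ τ : Matrix κ κ ℂ}
    (h : (l • τ - σ).PosSemidef) (Y : Matrix κ κ ℂ) : quadFun s l ρ τ Y ≤ quadFun s 1 ρ σ Y := by
  have h1 := (Complex.nonneg_iff.1 (h.conjTranspose_mul_mul_same Y).trace_nonneg).1
  rw [Matrix.mul_sub, Matrix.sub_mul, trace_sub, Matrix.mul_smul, Matrix.smul_mul, trace_smul,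
    Complex.sub_re, Complex.real_smul, Complex.re_ofReal_mul] at h1
  rw [quadFun, quadFun]
  linarith

lemma relEnt_average_le {P : Type*} [Fintype P] [Nonempty P] (e : P → κ ≃ κ)
    {ρ σ τ : Matrix κ κ ℂ} (hρ : ρ.PosSemidef) (hρ1 : ρ.trace = 1) (hσ : σ.PosSemidef)
    (hτ : τ.PosSemidef) {l : ℝ} (hl : 0 < l)
    (h : (l • τ - (Fintype.card P : ℝ)⁻¹ • ∑ p, σ.submatrix (e p) (e p)).PosSemidef) :
    relEnt ((Fintype.card P : ℝ)⁻¹ • ∑ p, ρ.submatrix (e p) (e p)) τ ≤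
      relEnt ρ σ + (Real.log l : ℝ) := by
  have hc : 0 < (Fintype.card P : ℝ)⁻¹ := by positivity
  by_cases hs : suppLE ρ σ
  swap
  · rw [relEnt, relEnt, if_neg hs, EReal.top_add_coe]
    exact le_top
  have hρ' : ((Fintype.card P : ℝ)⁻¹ • ∑ p, ρ.submatrix (e p) (e p)).PosSemidef :=
    (posSemidef_sum _ fun p _ => hρ.submatrix (e p)).smul hc.le
  have hσ' : ((Fintype.card P : ℝ)⁻¹ • ∑ p, σ.submatrix (e p) (e p)).PosSemidef :=
    (posSemidef_sum _ fun p _ => hσ.submatrix (e p)).smul hc.le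
  have hs' : suppLE ((Fintype.card P : ℝ)⁻¹ • ∑ p, ρ.submatrix (e p) (e p)) τ := by
    rw [suppLE_iff_ker hρ'.1 hτ.1]
    intro x hx
    have h0 : star x ⬝ᵥ (∑ p, σ.submatrix (e p) (e p)) *ᵥ x = 0 := by
      have h1 := h.dotProduct_mulVec_nonneg x
      rw [sub_mulVec, smul_mulVec, hx, smul_zero, zero_sub, dotProduct_neg] at h1
      have h2 := le_antisymm (neg_nonneg.1 h1) (hσ'.dotProduct_mulVec_nonneg x)
      rw [smul_mulVec, dotProduct_smul] at h2
      exact (smul_eq_zero.1 h2).resolve_left hc.ne'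
    rw [sum_mulVec, dotProduct_sum, Finset.sum_eq_zero_iff_of_nonneg
      fun p _ => (hσ.submatrix (e p)).dotProduct_mulVec_nonneg x] at h0
    rw [smul_mulVec, sum_mulVec, Finset.sum_eq_zero, smul_zero]
    intro p hp
    have h3 := ((hσ.submatrix (e p)).dotProduct_mulVec_zero_iff x).1 (h0 p hp)
    rw [submatrix_mulVec_equiv] at h3 ⊢
    have h4 : σ *ᵥ (x ∘ (e p).symm) = 0 := by
      ext i
      simpa using congrFun h3 ((e p).symm i)
    rw [(suppLE_iff_ker hρ.1 hσ.1).1 hs _ h4]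
    rfl
  have htr : ((Fintype.card P : ℝ)⁻¹ • ∑ p, ρ.submatrix (e p) (e p)).trace.re = ρ.trace.re := by
    simp [trace_smul, trace_sum, trace_submatrix_equiv_self, hρ1]
  rw [relEnt, relEnt, if_pos hs, if_pos hs', ← EReal.coe_add, EReal.coe_le_coe_iff]
  have key := trace_mul_matLog_sub_le hρ hσ hρ' hτ hs hs' htr hl fun s _ Y => by
    have h1 := quadFun_le_of_posSemidef_sub (s := s)
      (ρ := (Fintype.card P : ℝ)⁻¹ • ∑ p, ρ.submatrix (e p) (e p)) h Y
    rw [quadFun_average] at h1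
    obtain ⟨p, -, hp⟩ := Finset.exists_max_image Finset.univ
      (fun p => quadFun s 1 (ρ.submatrix (e p) (e p)) (σ.submatrix (e p) (e p)) Y)
      Finset.univ_nonempty
    refine ⟨Y.submatrix (e p).symm (e p).symm, h1.trans ?_⟩
    rw [← quadFun_submatrix s 1 ρ σ _ (e p), submatrix_submatrix]
    simp only [Equiv.symm_comp_self, submatrix_id_id]
    rw [inv_mul_le_iff₀ (by positivity)]
    simpa using Finset.sum_le_card_nsmul _ _ _ hp
  simpa [hρ1] using key

end Averaging

section Net

open Matrix

variable {ι : Type*} [Fintype ι]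

omit [Fintype ι] in
lemma PosSemidef.sum_smul {T : Type*} [Fintype T] {a : T → Matrix ι ι ℂ} {c : T → ℝ}
    (ha : ∀ t, (a t).PosSemidef) (hc : ∀ t, 0 ≤ c t) : (∑ t, c t • a t).PosSemidef :=
  posSemidef_sum _ fun t _ => (ha t).smul (hc t)

lemma IsState.norm_apply_le_one {ρ : MatC ι} (h : IsState ρ) (i j : ι) : ‖ρ i j‖ ≤ 1 := by
  have hd : ∀ k, ∃ x : ℝ, 0 ≤ x ∧ x ≤ 1 ∧ ρ k k = x := by
    intro k
    have h0 := h.1.diag_nonneg (i := k)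
    have h1 : ρ k k ≤ 1 := by
      rw [← h.2]
      exact Finset.single_le_sum (f := fun k => ρ k k) (fun l _ => h.1.diag_nonneg)
        (Finset.mem_univ k)
    obtain ⟨hx0, him⟩ := Complex.nonneg_iff.1 h0
    have hx : (((ρ k k).re : ℝ) : ℂ) = ρ k k := Complex.ext rfl him
    refine ⟨_, hx0, ?_, hx.symm⟩
    rw [← hx] at h1
    exact_mod_cast h1
  obtain ⟨x, hx0, hx1, hx⟩ := hd i
  obtain ⟨y, hy0, hy1, hy⟩ := hd j
  have hdet := (h.1.submatrix ![i, j]).det_nonneg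
  have hji : ρ j i = starRingEnd ℂ (ρ i j) := (h.1.1.apply j i).symm
  simp only [det_fin_two, submatrix_apply, cons_val_zero, cons_val_one, hx, hy, hji,
    Complex.mul_conj] at hdet
  have h2 : Complex.normSq (ρ i j) ≤ x * y := by exact_mod_cast sub_nonneg.1 hdet
  rw [Complex.normSq_eq_norm_sq] at h2
  have := mul_le_one₀ hx1 hy0 hy1
  nlinarith [norm_nonneg (ρ i j)]

lemma isCompact_of_isClosed_of_isState {B : Set (MatC ι)} (hB : ∀ σ ∈ B, IsState σ)
    (hc : IsClosed B) : IsCompact B := by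
  refine IsCompact.of_isClosed_subset (s := Set.univ.pi fun _ => Set.univ.pi fun _ =>
    Metric.closedBall (0 : ℂ) 1) ?_ hc ?_
  · exact isCompact_univ_pi fun _ => isCompact_univ_pi fun _ => isCompact_closedBall _ _
  · intro σ hσ i _ j _
    simpa using (hB σ hσ).norm_apply_le_one i j

/-- Up to a factor `L` close to `1`, every state of a compact set is dominated by a mixture of
finitely many states of the set. -/
lemma exists_finite_dominating {B : Set (MatC ι)} (hB : ∀ σ ∈ B, IsState σ) (hc : IsClosed B)
    {ε : ℝ} (hε : 0 < ε) :
    ∃ (T : Type) (_ : Fintype T) (a : T → MatC ι) (L : ℝ), (∀ t, a t ∈ B) ∧ 1 ≤ L ∧ L ≤ 1 + ε ∧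
      ∀ σ ∈ B, ∃ c : T → ℝ, (∀ t, 0 ≤ c t) ∧ ∑ t, c t = L ∧
        (∑ t, c t • a t - σ).PosSemidef := by
  obtain ⟨m, b, hb, hspan, hli⟩ : ∃ (m : ℕ) (b : Fin m → MatC ι), (∀ i, b i ∈ B) ∧
      Submodule.span ℝ (Set.range b) = Submodule.span ℝ B ∧ LinearIndependent ℝ b :=
    ⟨_, Submodule.exists_fun_fin_finrank_span_eq ℝ B⟩
  let bas := Module.Basis.span hli
  obtain ⟨φ, hφ⟩ := LinearMap.exists_extend bas.equivFun.toLinearMap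
  have hrep : ∀ σ ∈ Submodule.span ℝ B, ∑ i, φ σ i • b i = σ := by
    intro σ hσ
    have hσ' : σ ∈ Submodule.span ℝ (Set.range b) := hspan ▸ hσ
    have h1 : φ σ = bas.equivFun ⟨σ, hσ'⟩ := by
      rw [← LinearEquiv.coe_coe, ← hφ]
      rfl
    have h2 := congrArg Subtype.val (bas.sum_equivFun ⟨σ, hσ'⟩)
    rw [← h1] at h2
    simpa [bas, Module.Basis.span_apply] using h2
  have hφc : Continuous φ := LinearMap.continuous_of_finiteDimensional φ
  have hK := (isCompact_of_isClosed_of_isState hB hc).image hφc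
  set δ := ε / (m + 1) with hδ
  have hδ0 : 0 < δ := by positivity
  obtain ⟨N, hNK, hNfin, hN⟩ := hK.finite_cover_balls hδ0
  have hN' : ∀ x ∈ N, ∃ σ ∈ B, φ σ = x := fun x hx => hNK hx
  choose! g hgB hg using hN'
  have := hNfin.to_subtype
  obtain ⟨k, ⟨e⟩⟩ := Finite.exists_equiv_fin N
  refine ⟨Fin m ⊕ Fin k, inferInstance, Sum.elim b (fun t => g (e.symm t)), 1 + m * δ,
    ?_, ?_, ?_, ?_⟩
  · rintro (i | t)
    · exact hb i
    · exact hgB _ (e.symm t).2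
  · have : 0 ≤ m * δ := by positivity
    linarith
  · rw [hδ, mul_div_assoc', add_le_add_iff_left, div_le_iff₀ (by positivity)]
    nlinarith
  · intro σ hσ
    obtain ⟨x, hx, hσx⟩ := Set.mem_iUnion₂.1 (hN ⟨σ, hσ, rfl⟩)
    refine ⟨Sum.elim (fun _ => δ) (Pi.single (e ⟨x, hx⟩) 1), ?_, ?_, ?_⟩
    · rintro (i | t)
      · exact hδ0.le
      · exact (Pi.single_nonneg (α := fun _ => ℝ) (i := e ⟨x, hx⟩)).2 (zero_le_one : (0 : ℝ) ≤ 1) t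
    · simp [Fintype.sum_sum_type, add_comm]
    · have h1 : ∑ t : Fin k, (Pi.single (e ⟨x, hx⟩) (1 : ℝ) : Fin k → ℝ) t • g (e.symm t) = g x := by
        rw [Finset.sum_eq_single (e ⟨x, hx⟩)] <;> simp +contextual
      have h2 : ∑ i, δ • b i + g x - σ = ∑ i, (δ - (φ σ i - x i)) • b i := by
        have h3 := hrep (g x) (Submodule.subset_span (hgB x hx))
        rw [hg x hx] at h3
        simp only [sub_smul, Finset.sum_sub_distrib, hrep σ (Submodule.subset_span hσ), h3]
        abel
      rw [Fintype.sum_sum_type]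
      simp only [Sum.elim_inl, Sum.elim_inr, h1]
      rw [h2]
      refine PosSemidef.sum_smul (fun i => (hB _ (hb i)).1) fun i => ?_
      have h3 := (dist_le_pi_dist (φ σ) x i).trans (Metric.mem_ball.1 hσx).le
      rw [Real.dist_eq] at h3
      linarith [(abs_le.1 h3).2]

end Net

section Tensor

open Matrix
open scoped MatrixOrder

variable {ι : Type*} {n : ℕ}

lemma posSemidef_prod_entries [Finite ι] (A : Fin n → MatC ι) (hA : ∀ k, (A k).PosSemidef)
    (s : Finset (Fin n)) :
    (Matrix.of fun i j : Fin n → ι => ∏ k ∈ s, A k (i k) (j k)).PosSemidef := by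
  induction s using Finset.induction_on with
  | empty =>
    have h : (Matrix.of fun i j : Fin n → ι => ∏ k ∈ ∅, A k (i k) (j k)) =
        vecMulVec (fun _ => 1) (star fun _ => 1) := by
      ext i j
      simp [vecMulVec_apply]
    rw [h]
    exact posSemidef_vecMulVec_self_star _
  | insert k s hk ih =>
    have h : (Matrix.of fun i j : Fin n → ι => ∏ k ∈ insert k s, A k (i k) (j k)) =
        ((A k).submatrix (fun i => i k) fun i => i k) ⊙
          Matrix.of fun i j => ∏ k ∈ s, A k (i k) (j k) := by
      ext i j
      simp [Finset.prod_insert hk, hadamard_apply]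
    rw [h]
    exact ((hA k).submatrix fun i : Fin n → ι => i k).hadamard ih

lemma tensorProdFam_posSemidef [Finite ι] {A : Fin n → MatC ι} (hA : ∀ k, (A k).PosSemidef) :
    (tensorProdFam A).PosSemidef :=
  posSemidef_prod_entries A hA Finset.univ

lemma tensorProdFam_mono [Finite ι] {A B : Fin n → MatC ι} (hB : ∀ k, (B k).PosSemidef)
    (h : ∀ k, B k ≤ A k) : tensorProdFam B ≤ tensorProdFam A := by
  have hA : ∀ k, (A k).PosSemidef := fun k => by
    simpa using (hB k).add (le_iff.1 (h k))
  suffices key : ∀ s : Finset (Fin n), (Matrix.of fun i j : Fin n → ι =>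
      ∏ k ∈ s, A k (i k) (j k) - ∏ k ∈ s, B k (i k) (j k)).PosSemidef from
    le_iff.2 (key Finset.univ)
  intro s
  induction s using Finset.induction_on with
  | empty =>
    convert (PosSemidef.zero : (0 : MatN ι n).PosSemidef) using 1
    ext i j
    simp
  | insert k s hk ih =>
    have he : (Matrix.of fun i j : Fin n → ι =>
        ∏ k ∈ insert k s, A k (i k) (j k) - ∏ k ∈ insert k s, B k (i k) (j k)) =
        ((A k - B k).submatrix (fun i => i k) fun i => i k) ⊙
            (Matrix.of fun i j => ∏ k ∈ s, A k (i k) (j k)) +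
          ((B k).submatrix (fun i => i k) fun i => i k) ⊙
            Matrix.of fun i j => ∏ k ∈ s, A k (i k) (j k) - ∏ k ∈ s, B k (i k) (j k) := by
      ext i j
      simp only [of_apply, Finset.prod_insert hk, Matrix.add_apply, hadamard_apply,
        submatrix_apply, Matrix.sub_apply]
      ring
    rw [he]
    exact PosSemidef.add (((le_iff.1 (h k)).submatrix fun i : Fin n → ι => i k).hadamard
      (posSemidef_prod_entries A hA s))
      (((hB k).submatrix fun i : Fin n → ι => i k).hadamard ih)

lemma tensorProdFam_sum_smul {T : Type*} [Fintype T] (c : Fin n → T → ℝ) (a : T → MatC ι) :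
    tensorProdFam (fun k => ∑ t, c k t • a t) =
      ∑ f : Fin n → T, (∏ k, c k (f k)) • tensorProdFam fun k => a (f k) := by
  ext i j
  simp only [tensorProdFam, Matrix.sum_apply, Matrix.smul_apply, Finset.prod_univ_sum,
    Fintype.piFinset_univ, Complex.real_smul, Finset.prod_mul_distrib, Complex.ofReal_prod]

lemma permCopies_tensorProdFam (π : Equiv.Perm (Fin n)) (A : Fin n → MatC ι) :
    permCopies π (tensorProdFam A) = tensorProdFam fun k => A (π⁻¹ k) := by
  ext i j
  simp only [permCopies, tensorProdFam, Function.comp_apply]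
  rw [← Equiv.prod_comp π fun k => A (π⁻¹ k) (i k) (j k)]
  simp

end Tensor

section Counting

lemma factorial_mul_exp_le (k : ℕ) :
    (k.factorial : ℝ) * Real.exp k ≤ Real.exp 1 * (k + 1) * (k : ℝ) ^ k := by
  rcases Nat.eq_zero_or_pos k with rfl | hk
  · simp
  have key : (k.factorial : ℝ) * Real.exp k ≤ Real.exp 1 * k * (k : ℝ) ^ k := by
    induction k, hk using Nat.le_induction with
    | base => simp
    | succ k hk ih =>
      have hk0 : (0 : ℝ) < k := by exact_mod_cast hk
      have h1 : Real.exp 1 * (k : ℝ) ^ (k + 1) ≤ ((k : ℝ) + 1) ^ (k + 1) := by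
        have h := Real.one_sub_div_pow_le_exp_neg (n := k + 1) (t := 1) (by simp)
        push_cast at h
        have h2 : (1 : ℝ) - 1 / (k + 1) = k / (k + 1) := by field_simp; ring
        rw [h2, div_pow, Real.exp_neg, div_le_iff₀ (by positivity), inv_mul_eq_div,
          le_div_iff₀ (Real.exp_pos 1)] at h
        linarith
      push_cast [Nat.factorial_succ, Real.exp_add]
      calc ((k : ℝ) + 1) * k.factorial * (Real.exp k * Real.exp 1)
          = (k + 1) * Real.exp 1 * (k.factorial * Real.exp k) := by ring
        _ ≤ (k + 1) * Real.exp 1 * (Real.exp 1 * k * (k : ℝ) ^ k) := by gcongr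
        _ = (k + 1) * Real.exp 1 * (Real.exp 1 * (k : ℝ) ^ (k + 1)) := by ring
        _ ≤ (k + 1) * Real.exp 1 * ((k : ℝ) + 1) ^ (k + 1) := by gcongr
        _ = _ := by ring
  refine key.trans ?_
  gcongr
  linarith

lemma pow_mul_prod_factorial_le {T : Type*} [Fintype T] (m : T → ℕ) :
    ((∑ t, m t : ℕ) : ℝ) ^ (∑ t, m t) * ∏ t, ((m t).factorial : ℝ) ≤
      ((∑ t, m t).factorial : ℝ) * ((Real.exp 1 * ((∑ t, m t : ℕ) + 1)) ^ Fintype.card T *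
        ∏ t, (m t : ℝ) ^ m t) := by
  set n := ∑ t, m t with hn
  have h1 : (n : ℝ) ^ n ≤ n.factorial * Real.exp n := by
    have := Real.pow_div_factorial_le_exp (n : ℝ) n.cast_nonneg n
    rw [div_le_iff₀ (by positivity)] at this
    linarith
  calc (n : ℝ) ^ n * ∏ t, ((m t).factorial : ℝ)
      ≤ n.factorial * Real.exp n * ∏ t, ((m t).factorial : ℝ) := by gcongr
    _ = n.factorial * ∏ t, ((m t).factorial : ℝ) * Real.exp (m t) := by
        rw [Finset.prod_mul_distrib, ← Real.exp_sum, ← Nat.cast_sum]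
        ring
    _ ≤ n.factorial * ∏ t, Real.exp 1 * (n + 1) * (m t : ℝ) ^ m t := by
        gcongr ?_ * ?_
        refine Finset.prod_le_prod (fun t _ => by positivity) fun t _ => ?_
        refine (factorial_mul_exp_le (m t)).trans ?_
        have : m t ≤ n := Finset.single_le_sum (f := m) (fun _ _ => Nat.zero_le _)
          (Finset.mem_univ t)
        gcongr
    _ = _ := by
        rw [Finset.prod_mul_distrib, Finset.prod_const, Finset.card_univ]

variable {T : Type*} [Fintype T] {n : ℕ}

lemma card_perm_comp_eq_le (f h : Fin n → T) :
    (n : ℝ) ^ n * Nat.card {π : Equiv.Perm (Fin n) // f ∘ π = h} ≤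
      (n.factorial : ℝ) * ((Real.exp 1 * (n + 1)) ^ Fintype.card T *
        Nat.card {g : Fin n → Fin n // f ∘ g = h}) := by
  by_cases hex : ∃ π : Equiv.Perm (Fin n), f ∘ π = h
  swap
  · have : IsEmpty {π : Equiv.Perm (Fin n) // f ∘ π = h} := ⟨fun p => hex ⟨p.1, p.2⟩⟩
    rw [Nat.card_of_isEmpty]
    simp only [Nat.cast_zero, mul_zero]
    positivity
  obtain ⟨π₀, rfl⟩ := hex
  set m : T → ℕ := fun t => Fintype.card {k // f k = t} with hm
  have hsum : ∑ t, m t = n := by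
    rw [hm, ← Fintype.card_sigma, Fintype.card_congr (Equiv.sigmaFiberEquiv f), Fintype.card_fin]
  have h1 : Nat.card {π : Equiv.Perm (Fin n) // f ∘ π = f ∘ π₀} = ∏ t, (m t).factorial := by
    rw [← DomMulAct.stabilizer_card f, ← Nat.card_eq_fintype_card]
    refine Nat.card_congr ((Equiv.mulRight π₀⁻¹).subtypeEquiv fun π => ?_)
    rw [Equiv.coe_mulRight, Equiv.Perm.coe_mul, ← Function.comp_assoc]
    constructor
    · intro h
      rw [h, Function.comp_assoc, ← Equiv.Perm.coe_mul]
      simp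
    · intro h
      conv_rhs => rw [← h]
      rw [Function.comp_assoc, ← Equiv.Perm.coe_mul]
      simp
  have h2 : Nat.card {g : Fin n → Fin n // f ∘ g = f ∘ π₀} = ∏ t, m t ^ m t := by
    have e : {g : Fin n → Fin n // f ∘ g = f ∘ π₀} ≃ ∀ k, {j // f j = f (π₀ k)} :=
      (Equiv.subtypeEquivRight fun g => funext_iff).trans
        (Equiv.subtypePiEquivPi (p := fun k j => f j = f (π₀ k)))
    rw [Nat.card_congr e, Nat.card_eq_fintype_card, Fintype.card_pi]
    change ∏ k, m (f (π₀ k)) = _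
    rw [Equiv.prod_comp π₀ fun k => m (f k), ← Finset.prod_fiberwise' Finset.univ f m]
    refine Finset.prod_congr rfl fun t _ => ?_
    rw [Finset.prod_const, ← Fintype.card_subtype]
  have := pow_mul_prod_factorial_le m
  rw [hsum] at this
  rw [h1, h2]
  push_cast
  exact this

end Counting

section Types

open Matrix
open scoped MatrixOrder

variable {ι T : Type*} {n : ℕ}

lemma sum_comp_eq_sum_card_smul {S H V : Type*} [Fintype S] [Fintype H] [AddCommGroup V]
    [Module ℝ V] (g : S → H) (X : H → V) :
    ∑ s, X (g s) = ∑ h, (Nat.card {s // g s = h} : ℝ) • X h := by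
  rw [← Finset.sum_fiberwise' Finset.univ g X]
  refine Finset.sum_congr rfl fun h _ => ?_
  rw [Finset.sum_const, Nat.card_eq_fintype_card, Fintype.card_subtype, Nat.cast_smul_eq_nsmul]

lemma tensorPow_average (a : T → MatC ι) (f : Fin n → T) :
    tensorPow ((n : ℝ)⁻¹ • ∑ k, a (f k)) n =
      ((n : ℝ) ^ n)⁻¹ • ∑ g : Fin n → Fin n, tensorProdFam fun k => a (f (g k)) := by
  have h := tensorProdFam_sum_smul (fun (_ k : Fin n) => (n : ℝ)⁻¹) fun k => a (f k)
  rw [← Finset.smul_sum] at h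
  simp only [Finset.prod_const, Finset.card_univ, Fintype.card_fin, inv_pow,
    ← Finset.smul_sum] at h
  exact h

/-- The symmetrisation of a product of states drawn from a finite family is dominated, up to a
polynomial factor, by the tensor power of the average state. -/
lemma sum_permCopies_tensorProdFam_le [Finite ι] [Fintype T] {a : T → MatC ι}
    (ha : ∀ t, (a t).PosSemidef)
    (hn : n ≠ 0) (f : Fin n → T) :
    (n.factorial : ℝ)⁻¹ • ∑ π, permCopies π (tensorProdFam fun k => a (f k)) ≤
      ((Real.exp 1 * (n + 1)) ^ Fintype.card T) • tensorPow ((n : ℝ)⁻¹ • ∑ k, a (f k)) n := by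
  have hn0 : (0 : ℝ) < n := by positivity
  set X : (Fin n → T) → MatN ι n := fun h => tensorProdFam fun k => a (h k) with hX
  have h1 : ∑ π, permCopies π (tensorProdFam fun k => a (f k)) =
      ∑ h, (Nat.card {π : Equiv.Perm (Fin n) // f ∘ π = h} : ℝ) • X h := by
    rw [← sum_comp_eq_sum_card_smul (fun π : Equiv.Perm (Fin n) => f ∘ π) X,
      ← Equiv.sum_comp (Equiv.inv (Equiv.Perm (Fin n)))]
    refine Finset.sum_congr rfl fun π _ => ?_
    rw [permCopies_tensorProdFam]
    simp [hX]
  have h2 : ∑ g : Fin n → Fin n, tensorProdFam (fun k => a (f (g k))) =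
      ∑ h, (Nat.card {g : Fin n → Fin n // f ∘ g = h} : ℝ) • X h :=
    sum_comp_eq_sum_card_smul (fun g : Fin n → Fin n => f ∘ g) X
  rw [tensorPow_average, h1, h2, le_iff, smul_smul, Finset.smul_sum, Finset.smul_sum,
    ← Finset.sum_sub_distrib]
  refine posSemidef_sum _ fun h _ => ?_
  rw [smul_smul, smul_smul, ← sub_smul]
  refine (tensorProdFam_posSemidef fun k => ha (h k)).smul (sub_nonneg.2 ?_)
  rw [inv_mul_le_iff₀ (by positivity), ← mul_le_mul_iff_right₀ (pow_pos hn0 n)]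
  refine (card_perm_comp_eq_le f h).trans_eq ?_
  field_simp

end Types

section Comparison

open Matrix
open scoped MatrixOrder

variable {ι : Type*} {n : ℕ}

lemma convex_posSemidef (κ : Type*) : Convex ℝ {A : Matrix κ κ ℂ | A.PosSemidef} :=
  fun _ hA _ hB _ _ hs ht _ => (PosSemidef.smul hA hs).add (PosSemidef.smul hB ht)

lemma posSemidef_of_mem_convexHull_avSet [Fintype ι] {B : Set (MatC ι)}
    (hB : ∀ σ ∈ B, IsState σ) {σ : MatN ι n} (h : σ ∈ convexHull ℝ (avSet B n)) :
    σ.PosSemidef := by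
  refine convexHull_min ?_ (convex_posSemidef _) h
  rintro _ ⟨f, hf, rfl⟩
  exact tensorProdFam_posSemidef fun k => (hB _ (hf k)).1

lemma iidSet_subset_avSet (B : Set (MatC ι)) (n : ℕ) : iidSet B n ⊆ avSet B n := by
  rintro _ ⟨σ, hσ, rfl⟩
  exact ⟨fun _ => σ, fun _ => hσ, rfl⟩

/-- `ρ ↦ (n!)⁻¹ ∑ π, U_π ρ U_π†`. -/
def permAverage (ι : Type*) (n : ℕ) : MatN ι n →ₗ[ℝ] MatN ι n where
  toFun ρ := (n.factorial : ℝ)⁻¹ • ∑ π, permCopies π ρ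
  map_add' ρ σ := by
    rw [← smul_add, ← Finset.sum_add_distrib]
    rfl
  map_smul' c ρ := by
    rw [RingHom.id_apply, smul_comm, Finset.smul_sum (r := c)]
    rfl

lemma permAverage_mono {A B : MatN ι n} (h : A ≤ B) : permAverage ι n A ≤ permAverage ι n B := by
  rw [le_iff, ← map_sub]
  have h1 : (∑ π, permCopies π (B - A)).PosSemidef :=
    posSemidef_sum _ fun π _ => (le_iff.1 h).submatrix fun i => i ∘ π
  exact PosSemidef.smul h1 (inv_nonneg.2 (Nat.cast_nonneg n.factorial))

lemma tensorPow_average_mem_iidSet {B : Set (MatC ι)} (hconv : Convex ℝ B) {T : Type*}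
    {a : T → MatC ι} (ha : ∀ t, a t ∈ B) (hn : n ≠ 0) (f : Fin n → T) :
    tensorPow ((n : ℝ)⁻¹ • ∑ k, a (f k)) n ∈ iidSet B n := by
  refine ⟨_, ?_, rfl⟩
  rw [Finset.smul_sum]
  refine hconv.sum_mem (fun _ _ => by positivity) ?_ fun k _ => ha (f k)
  simp [hn]

/-- After symmetrisation, every mixture of arbitrarily varying product states is dominated by a
mixture of i.i.d. states up to the factor `L ^ n * (e (n + 1)) ^ |T|`. -/
lemma exists_iid_dominating [Fintype ι] {B : Set (MatC ι)} (hB : ∀ σ ∈ B, IsState σ)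
    (hconv : Convex ℝ B) {T : Type*} [Fintype T] {a : T → MatC ι} (ha : ∀ t, a t ∈ B) {L : ℝ}
    (hL : 0 < L)
    (hdom : ∀ σ ∈ B, ∃ c : T → ℝ, (∀ t, 0 ≤ c t) ∧ ∑ t, c t = L ∧
      (∑ t, c t • a t - σ).PosSemidef)
    (hn : n ≠ 0) {σ : MatN ι n} (hσ : σ ∈ convexHull ℝ (avSet B n)) :
    ∃ τ ∈ convexHull ℝ (iidSet B n), permAverage ι n σ ≤
      (L ^ n * (Real.exp 1 * (n + 1)) ^ Fintype.card T) • τ := by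
  set C : ℝ := (Real.exp 1 * (n + 1)) ^ Fintype.card T with hC
  suffices h : avSet B n ⊆ {σ | ∃ τ ∈ convexHull ℝ (iidSet B n),
      permAverage ι n σ ≤ (L ^ n * C) • τ} by
    refine convexHull_min h ?_ hσ
    rintro σ₁ ⟨τ₁, h₁, h₁'⟩ σ₂ ⟨τ₂, h₂, h₂'⟩ s t hs ht hst
    refine ⟨s • τ₁ + t • τ₂, convex_convexHull ℝ _ h₁ h₂ hs ht hst, ?_⟩
    have h3 := ((le_iff.1 h₁').smul hs).add ((le_iff.1 h₂').smul ht)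
    rw [le_iff, map_add, map_smul, map_smul]
    convert h3 using 1
    simp only [smul_sub, smul_add, smul_comm s, smul_comm t]
    abel
  rintro _ ⟨f, hf, rfl⟩
  choose c hc hcL hcf using fun k => hdom (f k) (hf k)
  refine ⟨∑ g : Fin n → T, ((∏ k, c k (g k)) / L ^ n) • tensorPow ((n : ℝ)⁻¹ • ∑ k, a (g k)) n,
    ?_, ?_⟩
  · refine (convex_convexHull ℝ _).sum_mem (fun g _ => ?_) ?_ fun g _ =>
      subset_convexHull ℝ _ (tensorPow_average_mem_iidSet hconv ha hn g)
    · have : 0 ≤ ∏ k, c k (g k) := Finset.prod_nonneg fun k _ => hc k _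
      positivity
    · have h := Finset.prod_univ_sum (fun _ : Fin n => (Finset.univ : Finset T)) c
      rw [Fintype.piFinset_univ] at h
      simp only [hcL, Finset.prod_const, Finset.card_univ, Fintype.card_fin] at h
      rw [← Finset.sum_div, ← h, div_self (by positivity)]
  calc permAverage ι n (tensorProdFam f)
      ≤ permAverage ι n (tensorProdFam fun k => ∑ t, c k t • a t) :=
        permAverage_mono (tensorProdFam_mono (fun k => (hB _ (hf k)).1) fun k =>
          le_iff.2 (hcf k))
    _ = ∑ g : Fin n → T, (∏ k, c k (g k)) • permAverage ι n (tensorProdFam fun k => a (g k)) := by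
        rw [tensorProdFam_sum_smul, map_sum]
        simp only [map_smul]
    _ ≤ ∑ g : Fin n → T, (∏ k, c k (g k)) • C • tensorPow ((n : ℝ)⁻¹ • ∑ k, a (g k)) n := by
        refine Finset.sum_le_sum fun g _ => ?_
        rw [le_iff, ← smul_sub]
        exact PosSemidef.smul (le_iff.1 (sum_permCopies_tensorProdFam_le
          (fun t => (hB _ (ha t)).1) hn g)) (Finset.prod_nonneg fun k _ => hc k _)
    _ = _ := by
        rw [Finset.smul_sum]
        refine Finset.sum_congr rfl fun g _ => ?_
        rw [smul_smul, smul_smul]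
        congr 1
        field_simp

lemma permAverage_mem {A : Set (MatN ι n)} (hA : Convex ℝ A)
    (hperm : ∀ ρ ∈ A, ∀ π : Equiv.Perm (Fin n), permCopies π ρ ∈ A) {ρ : MatN ι n} (hρ : ρ ∈ A) :
    permAverage ι n ρ ∈ A := by
  change (n.factorial : ℝ)⁻¹ • ∑ π, permCopies π ρ ∈ A
  rw [Finset.smul_sum]
  refine hA.sum_mem (fun _ _ => by positivity) ?_ fun π _ => hperm ρ hρ π
  simp [Fintype.card_perm, Nat.factorial_ne_zero]

end Comparison

section Regularisation

lemma liminf_le_liminf_of_forall_pos_le_add {u v : ℕ → EReal}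
    (h : ∀ η : ℝ, 0 < η → ∀ᶠ n in atTop, u n ≤ v n + η) :
    liminf u atTop ≤ liminf v atTop := by
  refine EReal.le_of_forall_lt_iff_le.1 fun z hz => ?_
  obtain ⟨y, hy, hyz⟩ := EReal.lt_iff_exists_real_btwn.1 hz
  have hyz' : y < z := EReal.coe_lt_coe_iff.1 hyz
  refine liminf_le_of_frequently_le ((((frequently_lt_of_liminf_lt (by isBoundedDefault)
    hy).and_eventually (h (z - y) (sub_pos.2 hyz'))).mono fun n hn => ?_)) (by isBoundedDefault)
  calc u n ≤ v n + (z - y : ℝ) := hn.2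
    _ ≤ y + (z - y : ℝ) := add_le_add_left hn.1.le _
    _ = z := by rw [← EReal.coe_add, add_sub_cancel]

lemma relEntSet_av_le_relEntSet_iid {d n : ℕ} (B : Set (MatC (Fin d))) (A : Set (MatN (Fin d) n)) :
    relEntSet A (convexHull ℝ (avSet B n)) ≤ relEntSet A (convexHull ℝ (iidSet B n)) :=
  iInf₂_mono fun _ _ => biInf_mono fun _ h => convexHull_mono (iidSet_subset_avSet B n) h

lemma cFrac_nonneg (n : ℕ) : 0 ≤ cFrac n := EReal.coe_nonneg.2 (by positivity)

lemma eventually_log_dominating_factor_le (t : ℕ) {L η : ℝ} (hL : 1 ≤ L) (hLη : L ≤ 1 + η / 2)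
    (hη : 0 < η) :
    ∀ᶠ n : ℕ in atTop,
      (n : ℝ)⁻¹ * Real.log (L ^ n * (Real.exp 1 * (n + 1)) ^ t) ≤ η := by
  have h1 : Tendsto (fun n : ℕ => (n : ℝ)⁻¹ * (t * (1 + Real.log (n + 1)))) atTop (𝓝 0) := by
    have h2 : Tendsto (fun n : ℕ => Real.log (n + 1) / (n + 1 : ℝ)) atTop (𝓝 0) :=
      (Real.isLittleO_log_id_atTop.tendsto_div_nhds_zero).comp
        (tendsto_atTop_add_const_right _ (1 : ℝ) tendsto_natCast_atTop_atTop)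
    have h3 : Tendsto (fun n : ℕ => (n : ℝ)⁻¹) atTop (𝓝 0) :=
      tendsto_inv_atTop_nhds_zero_nat
    have h4 := (h3.add (h2.mul (h3.const_add 1))).const_mul (t : ℝ)
    simp only [add_zero, mul_one, mul_zero] at h4
    refine h4.congr' ?_
    filter_upwards [eventually_gt_atTop 0] with n hn
    have : (0 : ℝ) < n := by exact_mod_cast hn
    field_simp
  filter_upwards [h1.eventually_lt_const (half_pos hη), eventually_gt_atTop 0] with n hn hn0
  have hn' : (0 : ℝ) < n := by exact_mod_cast hn0
  have hL0 : 0 < L := by linarith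
  rw [Real.log_mul (by positivity) (by positivity), Real.log_pow, Real.log_pow,
    Real.log_mul (by positivity) (by positivity), Real.log_exp, mul_add,
    inv_mul_cancel_left₀ hn'.ne']
  have := Real.log_le_sub_one_of_pos hL0
  linarith

lemma relEntSet_iid_le {d n : ℕ} {B : Set (MatC (Fin d))}
    (hB : ∀ σ ∈ B, IsState σ) {A : Set (MatN (Fin d) n)} (hA : ∀ ρ ∈ A, IsState ρ)
    (hconv : Convex ℝ A) (hperm : ∀ ρ ∈ A, ∀ π : Equiv.Perm (Fin n), permCopies π ρ ∈ A)
    {l : ℝ} (hl : 0 < l)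
    (hdom : ∀ σ ∈ convexHull ℝ (avSet B n), ∃ τ ∈ convexHull ℝ (iidSet B n),
      (l • τ - permAverage (Fin d) n σ).PosSemidef) :
    relEntSet A (convexHull ℝ (iidSet B n)) ≤
      relEntSet A (convexHull ℝ (avSet B n)) + (Real.log l : ℝ) := by
  rw [← EReal.sub_le_iff_le_add (Or.inl (EReal.coe_ne_bot _)) (Or.inl (EReal.coe_ne_top _))]
  refine le_iInf₂ fun ρ hρ => le_iInf₂ fun σ hσ => ?_
  rw [EReal.sub_le_iff_le_add (Or.inl (EReal.coe_ne_bot _)) (Or.inl (EReal.coe_ne_top _))]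
  obtain ⟨τ, hτ, hle⟩ := hdom σ hσ
  refine (iInf₂_le_of_le _ (permAverage_mem hconv hperm hρ) (iInf₂_le τ hτ)).trans ?_
  have key := relEnt_average_le
    (fun π : Equiv.Perm (Fin n) => Equiv.arrowCongr π.symm (Equiv.refl (Fin d)))
    (hA ρ hρ).1 (hA ρ hρ).2 (posSemidef_of_mem_convexHull_avSet hB hσ)
    (posSemidef_of_mem_convexHull_avSet hB (convexHull_mono (iidSet_subset_avSet B n) hτ)) hl
  rw [Fintype.card_perm, Fintype.card_fin] at key
  exact key hle

end Regularisation

/-- **Equality of regularised relative entropies for i.i.d. versus arbitrarily varying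
convexified alternative hypotheses:** `D^∞(𝒜‖co(ℬ₁^{iid})) = D^∞(𝒜‖co(ℬ₁^{av}))`. -/
theorem regularised_relEnt_iid_eq_av (d : ℕ)
    (B1 : Set (MatC (Fin d)))
    (hB_states : ∀ σ ∈ B1, IsState σ)
    (hB_ne : B1.Nonempty) (hB_closed : IsClosed B1) (hB_convex : Convex ℝ B1)
    (A : ∀ n : ℕ, Set (MatN (Fin d) n))
    (hA_states : ∀ n : ℕ, ∀ ρ ∈ A n, IsState ρ)
    (hA_convex : ∀ n : ℕ, Convex ℝ (A n))
    (hA_perm : ∀ n : ℕ, ∀ ρ ∈ A n, ∀ π : Equiv.Perm (Fin n), permCopies π ρ ∈ A n) :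
    Filter.liminf
      (fun n : ℕ => cFrac n * relEntSet (A n) (convexHull ℝ (iidSet B1 n))) Filter.atTop =
    Filter.liminf
      (fun n : ℕ => cFrac n * relEntSet (A n) (convexHull ℝ (avSet B1 n))) Filter.atTop := by
  refine le_antisymm (liminf_le_liminf_of_forall_pos_le_add fun η hη => ?_)
    (liminf_le_liminf (Eventually.of_forall fun n => mul_le_mul_of_nonneg_left
      (relEntSet_av_le_relEntSet_iid B1 (A n)) (cFrac_nonneg n)))
  obtain ⟨T, _, a, L, ha, hL1, hL2, hdom⟩ :=
    exists_finite_dominating hB_states hB_closed (half_pos hη)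
  filter_upwards [eventually_log_dominating_factor_le (Fintype.card T) hL1 hL2 hη,
    eventually_ne_atTop 0] with n hlog hn
  have hL0 : 0 < L := by linarith
  have hle := relEntSet_iid_le hB_states (hA_states n) (hA_convex n) (hA_perm n)
    (l := L ^ n * (Real.exp 1 * (n + 1)) ^ Fintype.card T) (by positivity) fun σ hσ =>
      exists_iid_dominating hB_states hB_convex ha hL0 hdom hn hσ
  refine (mul_le_mul_of_nonneg_left hle (cFrac_nonneg n)).trans ?_
  rw [EReal.left_distrib_of_nonneg_of_ne_top (cFrac_nonneg n) (EReal.coe_ne_top _)]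
  gcongr
  rw [cFrac, ← EReal.coe_mul]
  exact EReal.coe_le_coe_iff.2 hlog

end QSanov
end
end

section
/- Converse bound: the Stein exponent is upper bounded by the regularised relative entropy between the convexified hypotheses. Let ℋ be a finite-dimensional Hilbert space and 𝒜 = (𝒜_n)_n, ℬ = (ℬ_n)_n two sequences of sets of states 𝒜_n, ℬ_n ⊆ 𝒟(ℋ^{⊗n}). Then Stein(𝒜‖ℬ) ≤ D^∞(co(𝒜)‖co(ℬ)) = liminf_{n→∞} (1/n) inf_{ρ_n ∈ co(𝒜_n), σ_n ∈ co(ℬ_n)} D(ρ_n‖σ_n). -/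
open Filter MeasureTheory Topology
open scoped BigOperators Classical ComplexOrder

noncomputable section

namespace QSanov

lemma isState_of_mem_convexHull {κ : Type*} [Fintype κ] {A : Set (Matrix κ κ ℂ)}
    (hA : ∀ ρ ∈ A, IsState ρ) {ρ : Matrix κ κ ℂ} (hρ : ρ ∈ convexHull ℝ A) : IsState ρ := by
  refine convexHull_min (t := {ρ | IsState ρ}) hA ?_ hρ
  rintro x ⟨hx, hx'⟩ y ⟨hy, hy'⟩ a b ha hb hab
  refine ⟨(hx.smul ha).add (hy.smul hb), ?_⟩
  rw [Matrix.trace_add, Matrix.trace_smul, Matrix.trace_smul, hx', hy', ← add_smul, hab, one_smul]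

lemma trace_mul_le_of_mem_convexHull {κ : Type*} [Fintype κ] {A : Set (Matrix κ κ ℂ)}
    {X : Matrix κ κ ℂ} {c : ℝ}
    (hA : ∀ ρ ∈ A, (ρ * X).trace.re ≤ c) {ρ : Matrix κ κ ℂ} (hρ : ρ ∈ convexHull ℝ A) :
    (ρ * X).trace.re ≤ c := by
  refine convexHull_min (t := {ρ : Matrix κ κ ℂ | (ρ * X).trace.re ≤ c}) hA ?_ hρ
  intro x hx y hy a b ha hb hab
  simp only [Set.mem_ofPred_eq] at hx hy ⊢
  rw [add_mul, smul_mul_assoc, smul_mul_assoc, Matrix.trace_add, Matrix.trace_smul,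
    Matrix.trace_smul, Complex.add_re, Complex.smul_re, Complex.smul_re, smul_eq_mul, smul_eq_mul]
  calc a * (x * X).trace.re + b * (y * X).trace.re ≤ a * c + b * c := by gcongr
    _ = c := by rw [← add_mul, hab, one_mul]

section Spectral

variable {κ : Type*} [Fintype κ] [DecidableEq κ]

/-- A spectral decomposition of a positive semidefinite matrix, together with the induced
decomposition of its logarithm. -/
lemma exists_spectral {ρ : Matrix κ κ ℂ} (hρ : ρ.PosSemidef) :
    ∃ (U : Matrix κ κ ℂ) (r : κ → ℝ), star U * U = 1 ∧ U * star U = 1 ∧ (∀ i, 0 ≤ r i) ∧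
      ρ = U * Matrix.diagonal (fun i => (r i : ℂ)) * star U ∧
      matLog ρ = U * Matrix.diagonal (fun i => (Real.log (r i) : ℂ)) * star U := by
  refine ⟨hρ.isHermitian.eigenvectorUnitary, hρ.isHermitian.eigenvalues,
    Unitary.coe_star_mul_self _, Unitary.coe_mul_star_self _, hρ.eigenvalues_nonneg, ?_, ?_⟩
  · exact hρ.isHermitian.spectral_theorem
  · rw [matLog, dif_pos hρ.isHermitian]

lemma trace_diagonal_mul_mul_diagonal_mul_star (r s : κ → ℝ) (W : Matrix κ κ ℂ) :
    (Matrix.diagonal (fun i => (r i : ℂ)) * W * Matrix.diagonal (fun j => (s j : ℂ)) *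
      star W).trace.re = ∑ i, ∑ j, r i * s j * Complex.normSq (W i j) := by
  simp only [Matrix.trace, Matrix.diag, Matrix.mul_apply (N := star W), Matrix.mul_diagonal,
    Matrix.diagonal_mul, Matrix.star_apply, Complex.re_sum]
  refine Finset.sum_congr rfl fun i _ => Finset.sum_congr rfl fun j _ => ?_
  have h : (r i : ℂ) * W i j * (s j : ℂ) * star (W i j) =
      ((r i * s j * Complex.normSq (W i j) : ℝ) : ℂ) := by
    push_cast
    rw [← Complex.mul_conj]
    simp only [Complex.star_def]
    ring
  rw [h, Complex.ofReal_re]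

lemma trace_spectral_mul (U V X : Matrix κ κ ℂ) (r s : κ → ℝ) :
    (U * Matrix.diagonal (fun i => (r i : ℂ)) * star U * X *
      (V * Matrix.diagonal (fun j => (s j : ℂ)) * star V) * star X).trace.re =
      ∑ i, ∑ j, r i * s j * Complex.normSq ((star U * X * V) i j) := by
  rw [← trace_diagonal_mul_mul_diagonal_mul_star]
  congr 1
  simp only [star_mul, star_star, mul_assoc]
  rw [Matrix.trace_mul_comm]
  simp only [mul_assoc]

lemma trace_mul_nonneg_of_posSemidef {ρ X : Matrix κ κ ℂ} (hρ : ρ.PosSemidef)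
    (hX : X.PosSemidef) : 0 ≤ (ρ * X).trace.re := by
  obtain ⟨U, r, -, -, hr, hU, -⟩ := exists_spectral hρ
  obtain ⟨V, s, -, -, hs, hV, -⟩ := exists_spectral hX
  have h := trace_spectral_mul U V 1 r s
  rw [← hU, ← hV] at h
  simp only [mul_one, star_one] at h
  rw [h]
  exact Finset.sum_nonneg fun i _ => Finset.sum_nonneg fun j _ =>
    mul_nonneg (mul_nonneg (hr i) (hs j)) (Complex.normSq_nonneg _)

/-- `E² ≤ E` for an effect `0 ≤ E ≤ 1`, tested against a positive semidefinite matrix. -/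
lemma trace_mul_sq_le {ρ E : Matrix κ κ ℂ} (hρ : ρ.PosSemidef) (hE : E.PosSemidef)
    (hE' : (1 - E).PosSemidef) : (ρ * (E * E)).trace.re ≤ (ρ * E).trace.re := by
  have h1 := hE'.mul_mul_conjTranspose_same E
  have h2 := hE.mul_mul_conjTranspose_same (1 - E)
  rw [hE.isHermitian.eq] at h1
  rw [hE'.isHermitian.eq] at h2
  have h3 : E - E * E = E * (1 - E) * E + (1 - E) * E * (1 - E) := by noncomm_ring
  have h := trace_mul_nonneg_of_posSemidef hρ (h1.add h2)
  rw [← h3, mul_sub, Matrix.trace_sub, Complex.sub_re] at h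
  linarith

/-- If `supp ρ ⊆ supp σ`, eigenvectors of `ρ` with nonzero eigenvalue are orthogonal to the kernel
of `σ`. -/
lemma overlap_eq_zero_of_suppLE {U V : Matrix κ κ ℂ} {r s : κ → ℝ} (hU : star U * U = 1)
    (hV : star V * V = 1)
    (h : suppLE (U * Matrix.diagonal (fun i => (r i : ℂ)) * star U)
      (V * Matrix.diagonal (fun i => (s i : ℂ)) * star V)) {i j : κ} (hs : s j = 0) :
    r i * Complex.normSq ((star U * V) i j) = 0 := by
  have hX : ∀ k, ∃ x : κ → ℂ, (V * Matrix.diagonal (fun i => (s i : ℂ)) * star V).mulVec x =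
      (U * Matrix.diagonal (fun i => (r i : ℂ)) * star U).mulVec (Pi.single k 1) := fun k =>
    h ⟨Pi.single k 1, rfl⟩
  choose x hx using hX
  have hρ : U * Matrix.diagonal (fun i => (r i : ℂ)) * star U =
      V * Matrix.diagonal (fun i => (s i : ℂ)) * star V * Matrix.of (fun a k => x k a) := by
    ext a k
    have := congrFun (hx k) a
    rw [Matrix.mulVec_single_one] at this
    rw [Matrix.mul_apply]
    exact this.symm
  have h1 : star V * (U * Matrix.diagonal (fun i => (r i : ℂ))) =
      Matrix.diagonal (fun i => (s i : ℂ)) * (star V * Matrix.of (fun a k => x k a) * U) := by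
    have h2 := congrArg (fun M => star V * M * U) hρ
    simp only [mul_assoc, hU, mul_one] at h2
    rw [h2]
    simp only [← mul_assoc, hV, one_mul]
  have h3 := congrFun (congrFun h1 j) i
  rw [← mul_assoc, Matrix.mul_diagonal, Matrix.diagonal_mul, hs, Complex.ofReal_zero,
    zero_mul] at h3
  have h4 : (star U * V) i j = star ((star V * U) j i) := by
    rw [← Matrix.star_apply, star_mul, star_star]
  rcases mul_eq_zero.mp h3 with h5 | h5
  · rw [h4, h5]
    simp
  · rw [Complex.ofReal_eq_zero.mp h5, zero_mul]

/-- Pointwise estimate behind the lower bound on the relative entropy of the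
Nussbaum-Szkoła distributions. -/
lemma threshold_le_mul_log_sub {r s w t : ℝ} (hr : 0 ≤ r) (hs : 0 ≤ s) (hw : 0 ≤ w)
    (h0 : s = 0 → r * w = 0) :
    t * (if r ≤ Real.exp t * s then 0 else r * w) - s * w ≤
      r * Real.log r * w - r * Real.log s * w := by
  rcases eq_or_ne (r * w) 0 with h | h
  · have e1 : r * Real.log r * w - r * Real.log s * w = (r * w) * (Real.log r - Real.log s) := by
      ring
    rw [e1, h]
    simp only [ite_self]
    nlinarith [mul_nonneg hs hw]
  · have hs' : 0 < s := lt_of_le_of_ne hs fun h' => h (h0 h'.symm)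
    have hr' : 0 < r := lt_of_le_of_ne hr fun h' => h (by rw [← h', zero_mul])
    have hrw : 0 ≤ r * w := mul_nonneg hr hw
    split_ifs with hc
    · have h1 : Real.log (s / r) ≤ s / r - 1 := Real.log_le_sub_one_of_pos (div_pos hs' hr')
      rw [Real.log_div hs'.ne' hr'.ne'] at h1
      have h2 := mul_le_mul_of_nonneg_left h1 hrw
      have h3 : r * w * (s / r - 1) = s * w - r * w := by field_simp
      nlinarith
    · push Not at hc
      have h1 : t + Real.log s ≤ Real.log r := by
        rw [← Real.log_exp t, ← Real.log_mul (Real.exp_pos t).ne' hs'.ne']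
        exact Real.log_le_log (by positivity) hc.le
      nlinarith [mul_le_mul_of_nonneg_left h1 hrw, mul_nonneg hs hw]

/-- Pointwise estimate behind the lower bound on the error probabilities of a test. -/
lemma half_mul_normSq_add_le {r s c : ℝ} (hr : 0 ≤ r) (hs : 0 ≤ s) (hc : 0 ≤ c) (a b : ℂ) :
    (if r ≤ c * s then r * Complex.normSq (a + b) else 0) / 2 ≤
      r * Complex.normSq a + c * (s * Complex.normSq b) := by
  have ha := Complex.normSq_nonneg a
  have hb := Complex.normSq_nonneg b
  split_ifs with h
  · have h1 : Complex.normSq (a + b) / 2 ≤ Complex.normSq a + Complex.normSq b := by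
      simp only [Complex.normSq_apply, Complex.add_re, Complex.add_im]
      nlinarith [sq_nonneg (a.re - b.re), sq_nonneg (a.im - b.im)]
    have h2 := mul_le_mul_of_nonneg_left h1 hr
    have h3 := mul_le_mul_of_nonneg_right h hb
    linarith
  · have := mul_nonneg hr ha
    have := mul_nonneg hc (mul_nonneg hs hb)
    linarith

/-- One-shot converse: the error probabilities of any test between two states are bounded below in
terms of their relative entropy. -/
lemma one_shot_converse {ρ σ E : Matrix κ κ ℂ} (hρ : IsState ρ) (hσ : IsState σ)
    (hsupp : suppLE ρ σ) (hE : E.PosSemidef) (hE' : (1 - E).PosSemidef) {t : ℝ} (ht : 0 ≤ t) :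
    t * (1 - 2 * ((ρ * (1 - E)).trace.re + Real.exp t * (σ * E).trace.re)) ≤
      (ρ * (matLog ρ - matLog σ)).trace.re + 1 := by
  obtain ⟨U, r, hU, hU', hr, hρU, hlρ⟩ := exists_spectral hρ.1
  obtain ⟨V, s, hV, hV', hs, hσV, hlσ⟩ := exists_spectral hσ.1
  set w : κ → κ → ℝ := fun i j => Complex.normSq ((star U * V) i j) with hw
  have hw0 : ∀ i j, 0 ≤ w i j := fun i j => Complex.normSq_nonneg _
  have hd : (Matrix.diagonal (fun _ : κ => ((1 : ℝ) : ℂ))) = 1 := by simp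
  have hsum : ∑ i, ∑ j, r i * w i j = 1 := by
    have h := trace_spectral_mul U V 1 r 1
    simp only [Pi.one_apply, hd, mul_one, star_one, hV'] at h
    rw [← hρU, hρ.2, Complex.one_re] at h
    exact h.symm
  have hsum' : ∑ i, ∑ j, s j * w i j = 1 := by
    have h := trace_spectral_mul U V 1 1 s
    simp only [Pi.one_apply, hd, mul_one, one_mul, star_one, hU'] at h
    rw [← hσV, hσ.2, Complex.one_re] at h
    exact h.symm
  have hent : (ρ * (matLog ρ - matLog σ)).trace.re =
      ∑ i, ∑ j, (r i * Real.log (r i) * w i j - r i * Real.log (s j) * w i j) := by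
    simp only [Finset.sum_sub_distrib]
    rw [mul_sub, Matrix.trace_sub, Complex.sub_re]
    congr 1
    · have h := trace_spectral_mul U V 1 (fun i => r i * Real.log (r i)) 1
      simp only [Pi.one_apply, hd, mul_one, star_one, hV'] at h
      rw [← h, hlρ]
      nth_rewrite 1 [hρU]
      congr 2
      calc _ = U * Matrix.diagonal (fun i => (r i : ℂ)) * (star U * U) *
            Matrix.diagonal (fun i => (Real.log (r i) : ℂ)) * star U := by simp only [mul_assoc]
        _ = _ := by
          rw [hU, mul_one, mul_assoc U, Matrix.diagonal_mul_diagonal]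
          simp only [Complex.ofReal_mul]
    · have h := trace_spectral_mul U V 1 r (fun j => Real.log (s j))
      simp only [mul_one, star_one] at h
      rw [← h, hlσ, ← hρU]
  have hρE : ∑ i, ∑ j, r i * Complex.normSq ((star U * (1 - E) * V) i j) ≤
      (ρ * (1 - E)).trace.re := by
    have h := trace_spectral_mul U V (1 - E) r 1
    simp only [Pi.one_apply, hd, mul_one, hV'] at h
    rw [← h, ← hρU, Matrix.star_eq_conjTranspose, hE'.isHermitian.eq, mul_assoc]
    refine trace_mul_sq_le hρ.1 hE' ?_
    rwa [sub_sub_cancel]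
  have hσE : ∑ i, ∑ j, s j * Complex.normSq ((star U * E * V) i j) ≤ (σ * E).trace.re := by
    have h := trace_spectral_mul U V E 1 s
    simp only [Pi.one_apply, hd, mul_one, one_mul, hU'] at h
    rw [← h, ← hσV, Matrix.star_eq_conjTranspose, hE.isHermitian.eq, mul_assoc,
      Matrix.trace_mul_comm, mul_assoc]
    exact trace_mul_sq_le hσ.1 hE hE'
  have hsplit : ∀ i j, (star U * V) i j = (star U * (1 - E) * V) i j + (star U * E * V) i j := by
    intro i j
    rw [← Matrix.add_apply]
    rw [← add_mul, ← mul_add, sub_add_cancel, mul_one]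
  have htest : (∑ i, ∑ j, if r i ≤ Real.exp t * s j then r i * w i j else 0) / 2 ≤
      (ρ * (1 - E)).trace.re + Real.exp t * (σ * E).trace.re := by
    calc _ = ∑ i, ∑ j, (if r i ≤ Real.exp t * s j then r i * w i j else 0) / 2 := by
          simp only [Finset.sum_div]
      _ ≤ ∑ i, ∑ j, (r i * Complex.normSq ((star U * (1 - E) * V) i j) +
            Real.exp t * (s j * Complex.normSq ((star U * E * V) i j))) := by
          refine Finset.sum_le_sum fun i _ => Finset.sum_le_sum fun j _ => ?_
          simp only [hw, hsplit]
          exact half_mul_normSq_add_le (hr i) (hs j) (Real.exp_pos t).le _ _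
      _ ≤ _ := by
          have h := mul_le_mul_of_nonneg_left hσE (Real.exp_pos t).le
          simp only [Finset.mul_sum] at h
          simp only [Finset.sum_add_distrib]
          exact add_le_add hρE h
  have hcompl : ∑ i, ∑ j, (if r i ≤ Real.exp t * s j then 0 else r i * w i j) =
      1 - ∑ i, ∑ j, if r i ≤ Real.exp t * s j then r i * w i j else 0 := by
    rw [← hsum]
    simp only [← Finset.sum_sub_distrib]
    refine Finset.sum_congr rfl fun i _ => Finset.sum_congr rfl fun j _ => ?_
    split_ifs <;> ring
  have hlog : t * ∑ i, ∑ j, (if r i ≤ Real.exp t * s j then 0 else r i * w i j) - 1 ≤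
      (ρ * (matLog ρ - matLog σ)).trace.re := by
    rw [hent, ← hsum']
    simp only [Finset.mul_sum, ← Finset.sum_sub_distrib]
    refine Finset.sum_le_sum fun i _ => Finset.sum_le_sum fun j _ => ?_
    rw [hρU, hσV] at hsupp
    exact threshold_le_mul_log_sub (hr i) (hs j) (hw0 i j)
      fun h => overlap_eq_zero_of_suppLE hU hV hsupp h
  rw [hcompl] at hlog
  have := mul_le_mul_of_nonneg_left htest ht
  linarith

/-- Lower bound on the type II error of a test whose type I error is at most `ε`. -/
lemma exp_le_trace_of_typeI_le {ρ σ E : Matrix κ κ ℂ} (hρ : IsState ρ) (hσ : IsState σ)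
    (hsupp : suppLE ρ σ) (hE : E.PosSemidef) (hE' : (1 - E).PosSemidef) {ε : ℝ} (hε : 0 < ε)
    (hε' : ε < 1 / 4) (h : (ρ * (1 - E)).trace.re ≤ ε) :
    ε * Real.exp (-(((ρ * (matLog ρ - matLog σ)).trace.re + 2) / (1 - 4 * ε))) ≤
      (σ * E).trace.re := by
  set D := (ρ * (matLog ρ - matLog σ)).trace.re
  have hD : -1 ≤ D := by
    have := one_shot_converse hρ hσ hsupp hE hE' le_rfl
    linarith
  have hδ : 0 < 1 - 4 * ε := by linarith
  set t := (D + 2) / (1 - 4 * ε) with ht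
  have htpos : 0 < t := div_pos (by linarith) hδ
  have h1 := one_shot_converse hρ hσ hsupp hE hE' htpos.le
  have h2 : t * (1 - 4 * ε) = D + 2 := div_mul_cancel₀ _ hδ.ne'
  have h3 : ε ≤ Real.exp t * (σ * E).trace.re := by
    by_contra! hlt
    have : 1 - 4 * ε ≤ 1 - 2 * ((ρ * (1 - E)).trace.re + Real.exp t * (σ * E).trace.re) := by
      linarith
    have := mul_le_mul_of_nonneg_left this htpos.le
    change _ ≤ D + 1 at h1
    linarith
  rw [Real.exp_neg, ← div_eq_mul_inv, div_le_iff₀ (Real.exp_pos t), mul_comm]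
  exact h3

lemma exp_le_typeII {A B : Set (Matrix κ κ ℂ)} (hA : ∀ ρ ∈ A, IsState ρ)
    (hB : ∀ σ ∈ B, IsState σ) {ρ σ : Matrix κ κ ℂ} (hρ : ρ ∈ convexHull ℝ A)
    (hσ : σ ∈ convexHull ℝ B) (hsupp : suppLE ρ σ) {ε : ℝ} (hε : 0 < ε) (hε' : ε < 1 / 4) :
    ε * Real.exp (-(((ρ * (matLog ρ - matLog σ)).trace.re + 2) / (1 - 4 * ε))) ≤
      typeII A B ε := by
  refine le_csInf ⟨_, 1, Matrix.PosSemidef.one, by simpa using Matrix.PosSemidef.zero,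
    fun ρ _ => by simpa using hε.le, rfl⟩ ?_
  rintro b ⟨E, hE, hE', hAE, rfl⟩
  refine (exp_le_trace_of_typeI_le (isState_of_mem_convexHull hA hρ)
    (isState_of_mem_convexHull hB hσ) hsupp hE hE' hε hε'
    (trace_mul_le_of_mem_convexHull hAE hρ)).trans ?_
  suffices hbdd : BddAbove {x : ℝ | ∃ σ ∈ B, x = (σ * E).trace.re} from
    trace_mul_le_of_mem_convexHull (fun τ hτ => le_csSup hbdd ⟨τ, hτ, rfl⟩) hσ
  refine ⟨1, ?_⟩
  rintro x ⟨τ, hτ, rfl⟩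
  have h := trace_mul_nonneg_of_posSemidef (hB τ hτ).1 hE'
  rw [mul_sub, mul_one, Matrix.trace_sub, (hB τ hτ).2, Complex.sub_re, Complex.one_re] at h
  linarith

lemma negLog_typeII_le {A B : Set (Matrix κ κ ℂ)} (hA : ∀ ρ ∈ A, IsState ρ)
    (hB : ∀ σ ∈ B, IsState σ) {ε : ℝ} (hε : 0 < ε) (hε' : ε < 1 / 4) {x : ℝ}
    (hx : relEntSet (convexHull ℝ A) (convexHull ℝ B) < (x : EReal)) :
    negLog (typeII A B ε) ≤ (((x + 2) / (1 - 4 * ε) - Real.log ε : ℝ) : EReal) := by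
  simp only [relEntSet, iInf_lt_iff] at hx
  obtain ⟨ρ, hρ, σ, hσ, h⟩ := hx
  unfold relEnt at h
  split_ifs at h with hsupp
  · rw [EReal.coe_lt_coe_iff] at h
    have h1 := exp_le_typeII hA hB hρ hσ hsupp hε hε'
    have h2 : 0 < ε * Real.exp (-(((ρ * (matLog ρ - matLog σ)).trace.re + 2) / (1 - 4 * ε))) := by
      positivity
    rw [negLog, if_neg (not_le.mpr (h2.trans_le h1)), EReal.coe_le_coe_iff]
    have h3 := Real.log_le_log h2 h1
    rw [Real.log_mul hε.ne' (Real.exp_pos _).ne', Real.log_exp] at h3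
    have h4 : ((ρ * (matLog ρ - matLog σ)).trace.re + 2) / (1 - 4 * ε) ≤
        (x + 2) / (1 - 4 * ε) := by
      have : 0 < 1 - 4 * ε := by linarith
      gcongr
    linarith
  · exact absurd h not_top_lt

end Spectral

/-- For small `ε`, the exponent at threshold `ε` exceeds any upper bound on the regularised
relative entropy by a factor tending to `1`. -/
lemma liminf_negLog_typeII_le {ι : Type*} [Fintype ι] [DecidableEq ι]
    {A B : ∀ n : ℕ, Set (MatN ι n)} (hA : ∀ n : ℕ, ∀ ρ ∈ A n, IsState ρ)
    (hB : ∀ n : ℕ, ∀ σ ∈ B n, IsState σ) {ε : ℝ} (hε : 0 < ε) (hε' : ε < 1 / 4) {x : ℝ}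
    (hx : ∃ᶠ n : ℕ in atTop,
      cFrac n * relEntSet (convexHull ℝ (A n)) (convexHull ℝ (B n)) < (x : EReal)) :
    liminf (fun n : ℕ => cFrac n * negLog (typeII (A n) (B n) ε)) atTop ≤
      ((x / (1 - 4 * ε) + ε : ℝ) : EReal) := by
  refine liminf_le_of_frequently_le' ?_
  have hlim : Tendsto (fun n : ℕ => (2 / (1 - 4 * ε) - Real.log ε) / (n : ℝ)) atTop (𝓝 0) :=
    tendsto_const_div_atTop_nhds_zero_nat _
  refine (hx.and_eventually ((hlim.eventually_lt_const hε).and (eventually_gt_atTop 0))).mono ?_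
  rintro n ⟨hn, hn', hpos⟩
  have hn0 : (0 : ℝ) < n := by exact_mod_cast hpos
  have hc : (0 : EReal) ≤ cFrac n := EReal.coe_nonneg.mpr (by positivity)
  have hlt : relEntSet (convexHull ℝ (A n)) (convexHull ℝ (B n)) < ((n * x : ℝ) : EReal) := by
    by_contra! hle
    refine hn.not_ge ?_
    refine le_trans (le_of_eq ?_) (mul_le_mul_of_nonneg_left hle hc)
    rw [cFrac, ← EReal.coe_mul, inv_mul_cancel_left₀ hn0.ne']
  refine (mul_le_mul_of_nonneg_left (negLog_typeII_le (hA n) (hB n) hε hε' hlt) hc).trans ?_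
  rw [cFrac, ← EReal.coe_mul, EReal.coe_le_coe_iff]
  have h : (n : ℝ)⁻¹ * ((n * x + 2) / (1 - 4 * ε) - Real.log ε) =
      x / (1 - 4 * ε) + (2 / (1 - 4 * ε) - Real.log ε) / n := by
    have : 1 - 4 * ε ≠ 0 := by linarith
    field_simp
    ring
  rw [h]
  linarith

/-- **Converse bound:** the Stein exponent is upper bounded by the regularised relative
entropy between the convexified hypotheses,
`Stein(𝒜‖ℬ) ≤ D^∞(co(𝒜)‖co(ℬ)) = liminf_n (1/n) D(co(𝒜_n)‖co(ℬ_n))`. -/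
theorem stein_converse_bound {ι : Type*} [Fintype ι] [DecidableEq ι]
    (A B : ∀ n : ℕ, Set (MatN ι n))
    (hA_states : ∀ n : ℕ, ∀ ρ ∈ A n, IsState ρ)
    (hB_states : ∀ n : ℕ, ∀ σ ∈ B n, IsState σ) :
    steinExponent A B ≤
      Filter.liminf
        (fun n : ℕ => cFrac n * relEntSet (convexHull ℝ (A n)) (convexHull ℝ (B n)))
        Filter.atTop := by
  refine EReal.le_of_forall_lt_iff_le.mp fun x hx => ?_
  have hfreq := frequently_lt_of_liminf_lt (by isBoundedDefault) hx
  have hcont : ContinuousAt (fun ε : ℝ => x / (1 - 4 * ε) + ε) 0 := by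
    fun_prop (disch := norm_num)
  have hlim : Tendsto (fun ε : ℝ => ((x / (1 - 4 * ε) + ε : ℝ) : EReal)) (𝓝[>] 0)
      (𝓝 (x : EReal)) := by
    have h := (continuous_coe_real_ereal.tendsto _).comp
      (hcont.tendsto.mono_left (nhdsWithin_le_nhds (s := Set.Ioi 0)))
    simpa [Function.comp_def] using h
  refine ge_of_tendsto hlim ?_
  filter_upwards [Ioo_mem_nhdsGT (show (0 : ℝ) < 1 / 4 by norm_num)] with ε hε
  exact (iInf₂_le ε ⟨hε.1, hε.2.trans (by norm_num)⟩).trans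
    (liminf_negLog_typeII_le hA_states hB_states hε.1 hε.2 hfreq)

end QSanov
end
end

section
/- Asymptotic spectral pinching bound with explicit constants. Let ℋ be a Hilbert space of finite dimension d, and let ρ_n, σ_n ∈ 𝒟(ℋ^{⊗n}) be states on n copies of the system, with σ_n permutation invariant (U_π σ_n U_π† = σ_n for all π ∈ S_n, where U_π permutes the tensor factors). Then D(ρ_n‖σ_n) − (d−1)(d/2+1) log(n+1) ≤ D^ALL(ρ_n‖σ_n) ≤ D(ρ_n‖σ_n). -/
open Filter MeasureTheory Topology
open scoped BigOperators Classical ComplexOrder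

noncomputable section

namespace QSanov

section PermutationInvariants

open scoped Matrix

/-- The commutant of the permutation action: matrices on `n` copies that are invariant under
simultaneous permutations of the row and column indices. -/
def permInvariant (ι : Type*) [Fintype ι] [DecidableEq ι] (n : ℕ) : Subalgebra ℂ (MatN ι n) where
  carrier := {f | ∀ (π : Equiv.Perm (Fin n)) (i j : Fin n → ι), f (i ∘ π) (j ∘ π) = f i j}
  mul_mem' := by
    intro f g hf hg π i j
    simp only [Matrix.mul_apply]
    rw [← (Equiv.arrowCongr π.symm (Equiv.refl ι)).sum_comp]
    refine Finset.sum_congr rfl fun c _ => ?_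
    have h : (Equiv.arrowCongr π.symm (Equiv.refl ι)) c = c ∘ π := by ext; simp
    rw [h, hf π, hg π]
  add_mem' := by
    intro f g hf hg π i j
    simp [hf π i j, hg π i j]
  algebraMap_mem' := by
    intro r π i j
    have h : i ∘ π = j ∘ π ↔ i = j := π.surjective.injective_comp_right.eq_iff
    simp [Matrix.algebraMap_matrix_apply, h]

/-- The sum over all positions `l` with `j l = b` of the entry of `f` whose column index has
`b` replaced by `a` at `l`; this is right multiplication by the derivation `E_{ab}`. -/
def lowerColumn {ι : Type*} [DecidableEq ι] {n : ℕ} (a b : ι) (f : MatN ι n) : MatN ι n :=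
  fun i j => ∑ l, if j l = b then f i (Function.update j l a) else 0

/-- Permutation-invariant matrices annihilated from the right by all strictly upper triangular
derivations: the highest weight vectors for the right action. -/
def highestWeight (d n : ℕ) : Submodule ℂ (MatN (Fin d) n) where
  carrier := {f | f ∈ permInvariant (Fin d) n ∧ ∀ a b, a < b → lowerColumn a b f = 0}
  add_mem' := by
    rintro f g ⟨hf, hf'⟩ ⟨hg, hg'⟩
    refine ⟨add_mem hf hg, fun a b hab => ?_⟩
    have : lowerColumn a b (f + g) = lowerColumn a b f + lowerColumn a b g := by
      ext i j
      simp only [lowerColumn, Matrix.add_apply, ← Finset.sum_add_distrib]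
      refine Finset.sum_congr rfl fun l _ => ?_
      split_ifs <;> simp
    rw [this, hf' a b hab, hg' a b hab, add_zero]
  zero_mem' := ⟨zero_mem _, fun a b _ => by ext; simp [lowerColumn]⟩
  smul_mem' := by
    rintro c f ⟨hf, hf'⟩
    refine ⟨Subalgebra.smul_mem _ hf c, fun a b hab => ?_⟩
    have : lowerColumn a b (c • f) = c • lowerColumn a b f := by
      ext i j
      simp [lowerColumn, Finset.mul_sum]
    rw [this, hf' a b hab, smul_zero]

lemma lowerColumn_mem_permInvariant {ι : Type*} [Fintype ι] [DecidableEq ι] {n : ℕ} (a b : ι)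
    {f : MatN ι n}
    (hf : f ∈ permInvariant ι n) : lowerColumn a b f ∈ permInvariant ι n := by
  intro π i j
  simp only [lowerColumn]
  rw [← Equiv.sum_comp π (fun l => if j l = b then f i (Function.update j l a) else 0)]
  refine Finset.sum_congr rfl fun l _ => ?_
  have h : Function.update (j ∘ π) l a = Function.update j (π l) a ∘ π := by
    rw [Function.update_comp_eq_of_injective _ π.injective]
  rw [h, hf π]
  rfl

lemma mul_lowerColumn {ι : Type*} [Fintype ι] [DecidableEq ι] {n : ℕ} (a b : ι) (s f : MatN ι n) :
    s * lowerColumn a b f = lowerColumn a b (s * f) := by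
  ext i j
  simp only [lowerColumn, Matrix.mul_apply, Finset.mul_sum]
  rw [Finset.sum_comm]
  refine Finset.sum_congr rfl fun l _ => ?_
  split_ifs <;> simp

/-- The defect of a pair of indices: it vanishes exactly when `i ≤ j` pointwise. -/
def orderDefect {d n : ℕ} (i j : Fin n → Fin d) : ℕ :=
  ∑ k, if j k < i k then (i k : ℕ) - j k + 1 else 0

lemma orderDefect_update_lt {d n : ℕ} (i j : Fin n → Fin d) {k l : Fin n} (hk : j k < i k)
    (hl : j l = i k) (hil : i l ≠ i k) :
    orderDefect i (Function.update (Function.update j k (i k)) l (j k)) < orderDefect i j := by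
  have hkl : k ≠ l := fun h => hil (by rw [h])
  unfold orderDefect
  rw [← Finset.add_sum_erase _ _ (Finset.mem_univ k),
    ← Finset.add_sum_erase _ _ (Finset.mem_univ k),
    ← Finset.add_sum_erase (Finset.univ.erase k) _ (a := l) (by simp [hkl.symm]),
    ← Finset.add_sum_erase (Finset.univ.erase k) _ (a := l) (by simp [hkl.symm]), ← add_assoc,
    ← add_assoc]
  refine add_lt_add_of_lt_of_le ?_ (le_of_eq ?_)
  · simp only [Function.update_self, Function.update_of_ne hkl, hl, lt_irrefl, if_false,
      hk, if_true]
    have h1 : (i l : ℕ) ≠ i k := fun h => hil (Fin.ext h)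
    have h2 : (j k : ℕ) < i k := hk
    simp only [Fin.lt_def]
    split_ifs <;> omega
  · refine Finset.sum_congr rfl fun m hm => ?_
    simp only [Finset.mem_erase, Finset.mem_univ, and_true] at hm
    rw [Function.update_of_ne hm.1, Function.update_of_ne hm.2]

/-- A highest weight matrix is determined by its entries with `i ≤ j` pointwise. -/
lemma highestWeight_eq_zero {d n : ℕ} {f : MatN (Fin d) n} (hf : f ∈ highestWeight d n)
    (h0 : ∀ i j, (∀ k, i k ≤ j k) → f i j = 0) : f = 0 := by
  suffices H : ∀ m i j, orderDefect i j = m → f i j = 0 by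
    ext i j
    exact H _ i j rfl
  intro m
  induction m using Nat.strong_induction_on with
  | _ m ih =>
    intro i j hm
    by_cases hv : ∀ k, i k ≤ j k
    · exact h0 i j hv
    push Not at hv
    obtain ⟨k, hk⟩ := hv
    have heq := congrFun (congrFun (hf.2 (j k) (i k) hk) i) (Function.update j k (i k))
    have hterm : ∀ l, (if Function.update j k (i k) l = i k then
        f i (Function.update (Function.update j k (i k)) l (j k)) else 0) =
        if Function.update j k (i k) l = i k ∧ i l = i k then f i j else 0 := by
      intro l
      by_cases h1 : Function.update j k (i k) l = i k
      · by_cases h2 : i l = i k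
        · simp only [h1, h2, and_self, if_true]
          rw [← hf.1 (Equiv.swap k l) i j]
          congr 1
          · ext x
            rcases eq_or_ne x k with rfl | hx
            · simp [h2]
            · rcases eq_or_ne x l with rfl | hx'
              · simp [h2]
              · simp [Equiv.swap_apply_of_ne_of_ne hx hx']
          · ext x
            rcases eq_or_ne x l with rfl | hx
            · simp
            · rcases eq_or_ne x k with rfl | hx'
              · simp [Function.update_of_ne hx]
                rw [Function.update_of_ne hx.symm] at h1
                rw [h1]
              · simp [Function.update_of_ne hx, Function.update_of_ne hx',
                  Equiv.swap_apply_of_ne_of_ne hx' hx]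
        · have hlk : l ≠ k := fun h => h2 (by rw [h])
          rw [if_pos h1, if_neg (fun h => h2 h.2)]
          rw [Function.update_of_ne hlk] at h1
          exact ih _ (hm ▸ orderDefect_update_lt i j hk h1 h2) _ _ rfl
      · rw [if_neg h1, if_neg (fun h => h1 h.1)]
    simp only [lowerColumn, hterm, Matrix.zero_apply] at heq
    rw [← Finset.sum_filter, Finset.sum_const, nsmul_eq_mul, mul_eq_zero] at heq
    exact heq.resolve_left
      (Nat.cast_ne_zero.mpr (Finset.card_ne_zero.mpr ⟨k, by simp⟩))

lemma exists_mul_eq_smul_permInvariant {ι : Type*} [Fintype ι] [DecidableEq ι] {n : ℕ}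
    {σ : MatN ι n}
    (hσ : σ ∈ permInvariant ι n) {s : ℂ} {v : (Fin n → ι) → ℂ} (hv : v ≠ 0)
    (hs : σ *ᵥ v = s • v) : ∃ f ∈ permInvariant ι n, f ≠ 0 ∧ σ * f = s • f := by
  by_contra! hcon
  let τ : permInvariant ι n := ⟨σ, hσ⟩ - algebraMap ℂ _ s
  have hτ : (τ : MatN ι n) = σ - s • 1 := by simp [τ, Algebra.algebraMap_eq_smul_one]
  have hinj : Function.Injective (LinearMap.mulLeft ℂ τ) := by
    rw [injective_iff_map_eq_zero]
    intro f hf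
    by_contra hne
    refine hcon f f.2 (fun h => hne (Subtype.ext h)) ?_
    have := congrArg Subtype.val hf
    simp only [LinearMap.mulLeft_apply, MulMemClass.coe_mul, hτ, sub_mul, smul_mul_assoc, one_mul,
      ZeroMemClass.coe_zero] at this
    exact sub_eq_zero.mp this
  obtain ⟨g, hg⟩ := LinearMap.injective_iff_surjective.mp hinj 1
  have hg' : (σ - s • 1) * (g : MatN ι n) = 1 := by
    rw [← hτ]
    exact congrArg Subtype.val hg
  rw [mul_eq_one_comm] at hg'
  apply hv
  have : (σ - s • (1 : MatN ι n)) *ᵥ v = 0 := by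
    rw [Matrix.sub_mulVec, hs, Matrix.smul_mulVec, Matrix.one_mulVec, sub_self]
  rw [← Matrix.one_mulVec v, ← hg', ← Matrix.mulVec_mulVec, this, Matrix.mulVec_zero]

/-- The weight of a column index. -/
def indexWeight {d n : ℕ} (j : Fin n → Fin d) : ℕ := ∑ l, (j l : ℕ)

lemma indexWeight_comp_perm {d n : ℕ} (j : Fin n → Fin d) (π : Equiv.Perm (Fin n)) :
    indexWeight (j ∘ π) = indexWeight j :=
  Equiv.sum_comp π fun l => (j l : ℕ)

lemma indexWeight_update_lt {d n : ℕ} {j : Fin n → Fin d} {l : Fin n} {a : Fin d} (h : a < j l) :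
    indexWeight (Function.update j l a) < indexWeight j := by
  refine Finset.sum_lt_sum (fun m _ => ?_) ⟨l, Finset.mem_univ l, by simpa using h⟩
  rcases eq_or_ne m l with rfl | hm
  · simpa using h.le
  · simp [Function.update_of_ne hm]

/-- Every eigenvalue of a permutation-invariant matrix is attained on a highest weight matrix. -/
lemma exists_mul_eq_smul_highestWeight {d n : ℕ} {σ : MatN (Fin d) n}
    (hσ : σ ∈ permInvariant (Fin d) n) {s : ℂ} {v : (Fin n → Fin d) → ℂ} (hv : v ≠ 0)
    (hs : σ *ᵥ v = s • v) : ∃ f ∈ highestWeight d n, f ≠ 0 ∧ σ * f = s • f := by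
  let W : Set ℕ := {w | ∃ f ∈ permInvariant (Fin d) n, σ * f = s • f ∧
    ∃ i j, indexWeight j = w ∧ f i j ≠ 0}
  have hWfin : W.Finite :=
    (Set.finite_range (indexWeight (d := d) (n := n))).subset
      (by rintro w ⟨f, -, -, i, j, rfl, -⟩; exact ⟨j, rfl⟩)
  have hWne : W.Nonempty := by
    obtain ⟨f, hf, hf0, hsf⟩ := exists_mul_eq_smul_permInvariant hσ hv hs
    obtain ⟨i, j, hij⟩ : ∃ i j, f i j ≠ 0 := by
      by_contra! h
      exact hf0 (Matrix.ext h)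
    exact ⟨_, f, hf, hsf, i, j, rfl, hij⟩
  obtain ⟨w, ⟨f, hf, hsf, i₀, j₀, hw, hne⟩, hmax⟩ := hWfin.exists_maximal hWne
  have hproj : ∀ f : MatN (Fin d) n,
      σ * (Matrix.of fun i j => if indexWeight j = w then f i j else 0) =
        Matrix.of fun i j => if indexWeight j = w then (σ * f) i j else 0 := by
    intro f
    ext i j
    simp only [Matrix.mul_apply, Matrix.of_apply]
    split_ifs <;> simp
  set g : MatN (Fin d) n := Matrix.of fun i j => if indexWeight j = w then f i j else 0 with hg
  have hgB : g ∈ permInvariant (Fin d) n := by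
    intro π i j
    simp only [hg, Matrix.of_apply, indexWeight_comp_perm, hf π i j]
  have hsg : σ * g = s • g := by
    rw [hg, hproj, hsf]
    ext i j
    simp
  refine ⟨g, ⟨hgB, fun a b hab => ?_⟩, fun h => hne ?_, hsg⟩
  · by_contra hne'
    obtain ⟨i, j, hij⟩ : ∃ i j, lowerColumn a b g i j ≠ 0 := by
      by_contra! h
      exact hne' (Matrix.ext h)
    have hmem : indexWeight j ∈ W := by
      refine ⟨_, lowerColumn_mem_permInvariant a b hgB, ?_, i, j, rfl, hij⟩
      rw [mul_lowerColumn, hsg]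
      ext i j
      simp [lowerColumn, Finset.mul_sum]
    obtain ⟨l, -, hl⟩ := Finset.exists_ne_zero_of_sum_ne_zero hij
    have hjl : j l = b := by
      by_contra h
      simp [h] at hl
    simp only [hjl, if_true, hg, Matrix.of_apply] at hl
    have hwl : indexWeight (Function.update j l a) = w := by
      by_contra h
      simp [h] at hl
    have hlt := indexWeight_update_lt (j := j) (l := l) (a := a) (hjl ▸ hab)
    rw [hwl] at hlt
    exact absurd (hmax hmem hlt.le) (not_le.mpr hlt)
  · have := congrFun (congrFun h i₀) j₀
    simpa [hg, hw] using this

lemma exists_perm_of_map_univ_eq {α β : Type*} [Fintype α] {c c' : α → β}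
    (h : Finset.univ.val.map c = Finset.univ.val.map c') :
    ∃ π : Equiv.Perm α, c' ∘ π = c := by
  have hcard : ∀ p, Nonempty ({k // c k = p} ≃ {k // c' k = p}) := by
    intro p
    rw [← Fintype.card_eq, Fintype.card_subtype, Fintype.card_subtype]
    have := congrArg (Multiset.count p) h
    rw [Multiset.count_map, Multiset.count_map] at this
    simpa only [Finset.card_def, Finset.filter_val, eq_comm] using this
  exact ⟨Equiv.ofFiberEquiv fun p => (hcard p).some, funext fun k => Equiv.ofFiberEquiv_map _ k⟩

/-- The dimension of the space of highest weight matrices is at most the number of multisets of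
`n` pairs `a ≤ b`. -/
lemma finrank_highestWeight_le (d n : ℕ) :
    Module.finrank ℂ (highestWeight d n) ≤
      Nat.multichoose (Fintype.card {p : Fin d × Fin d // p.1 ≤ p.2}) n := by
  let P := {p : Fin d × Fin d // p.1 ≤ p.2}
  let Φ : MatN (Fin d) n →ₗ[ℂ] (Sym P n → ℂ) :=
    { toFun := fun f m => if h : ∃ c : Fin n → P, Finset.univ.val.map c = m.1 then
        f (fun k => (h.choose k).1.1) (fun k => (h.choose k).1.2) else 0
      map_add' := by
        intro f g
        ext m
        by_cases h : ∃ c : Fin n → P, Finset.univ.val.map c = m.1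
        · simp only [Pi.add_apply, dif_pos h]; rfl
        · simp only [Pi.add_apply, dif_neg h]; simp
      map_smul' := by
        intro r f
        ext m
        by_cases h : ∃ c : Fin n → P, Finset.univ.val.map c = m.1
        · simp only [Pi.smul_apply, dif_pos h]; rfl
        · simp only [Pi.smul_apply, dif_neg h]; simp }
  have hinj : Function.Injective (Φ ∘ₗ (highestWeight d n).subtype) := by
    rw [injective_iff_map_eq_zero]
    intro f hf
    refine Subtype.ext (highestWeight_eq_zero f.2 fun i j hij => ?_)
    let c : Fin n → P := fun k => ⟨(i k, j k), hij k⟩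
    have hf' := congrFun hf ⟨Finset.univ.val.map c, by simp⟩
    have hex : ∃ c' : Fin n → P, Finset.univ.val.map c' = Finset.univ.val.map c := ⟨c, rfl⟩
    obtain ⟨π, hπ⟩ := exists_perm_of_map_univ_eq hex.choose_spec
    simp only [Φ, LinearMap.comp_apply, LinearMap.coe_mk, AddHom.coe_mk, Submodule.subtype_apply,
      dif_pos hex] at hf'
    rw [← hπ] at hf'
    exact (f.2.1 π i j).symm.trans hf'
  have := LinearMap.finrank_le_finrank_of_injective hinj
  rwa [Module.finrank_fintype_fun_eq_card, Sym.card_sym_eq_multichoose] at this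

/-- A set of eigenvalues of a permutation-invariant matrix has at most as many elements as there
are multisets of `n` pairs `a ≤ b`. -/
lemma card_eigenvalues_le_multichoose {d n : ℕ} {σ : MatN (Fin d) n}
    (hσ : σ ∈ permInvariant (Fin d) n) (S : Finset ℂ)
    (hS : ∀ s ∈ S, ∃ v : (Fin n → Fin d) → ℂ, v ≠ 0 ∧ σ *ᵥ v = s • v) :
    S.card ≤ Nat.multichoose (Fintype.card {p : Fin d × Fin d // p.1 ≤ p.2}) n := by
  have hex : ∀ s : S, ∃ f : highestWeight d n, f ≠ 0 ∧ σ * (f : MatN (Fin d) n) = (s : ℂ) • f := by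
    rintro ⟨s, hs⟩
    obtain ⟨v, hv, hsv⟩ := hS s hs
    obtain ⟨f, hf, hf0, hsf⟩ := exists_mul_eq_smul_highestWeight hσ hv hsv
    exact ⟨⟨f, hf⟩, fun h => hf0 (congrArg Subtype.val h), hsf⟩
  choose f hf0 hsf using hex
  have hli : LinearIndependent ℂ fun s : S => (f s : MatN (Fin d) n) := by
    refine Module.End.eigenvectors_linearIndependent' (LinearMap.mulLeft ℂ σ)
      (fun s : S => (s : ℂ)) Subtype.coe_injective _ fun s => ⟨?_, fun h => hf0 s (Subtype.ext h)⟩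
    rw [Module.End.mem_eigenspace_iff]
    exact hsf s
  have hli' : LinearIndependent ℂ f :=
    LinearIndependent.of_comp (highestWeight d n).subtype hli
  calc S.card = Fintype.card S := (Fintype.card_coe S).symm
    _ ≤ Module.finrank ℂ (highestWeight d n) := hli'.fintype_card_le_finrank
    _ ≤ _ := finrank_highestWeight_le d n

lemma multichoose_succ_le_pow (m n : ℕ) : Nat.multichoose (m + 1) n ≤ (n + 1) ^ m := by
  induction m generalizing n with
  | zero => simp
  | succ m ihm =>
    induction n with
    | zero => simp
    | succ n ihn =>
      rw [Nat.multichoose_succ_succ]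
      calc _ ≤ (n + 1 + 1) ^ m + (n + 1) ^ (m + 1) := add_le_add (ihm _) ihn
        _ ≤ (n + 1 + 1) ^ m + (n + 1) * (n + 1 + 1) ^ m := by
          rw [pow_succ (n + 1), mul_comm]
          gcongr
          all_goals omega
        _ = _ := by ring

lemma two_mul_card_pairs (d : ℕ) :
    2 * Fintype.card {p : Fin d × Fin d // p.1 ≤ p.2} = d * (d + 1) := by
  have h : Fintype.card {p : Fin d × Fin d // p.1 ≤ p.2} = ∑ j : Fin d, ((j : ℕ) + 1) := by
    rw [Fintype.card_subtype, ← Finset.univ_product_univ, Finset.card_filter,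
      Finset.sum_product_right]
    refine Finset.sum_congr rfl fun j _ => ?_
    rw [← Finset.card_filter]
    simp [Finset.filter_ge_eq_Iic]
  rw [h, Fin.sum_univ_eq_sum_range (fun j => j + 1), Finset.mul_sum]
  clear h
  induction d with
  | zero => simp
  | succ d ih =>
    rw [Finset.sum_range_succ, ih]
    ring

/-- The logarithm of the number of eigenvalues is bounded as in the Schur-Weyl count. -/
lemma log_card_le_of_le_multichoose {d n N : ℕ} (hN : 1 ≤ N)
    (h : N ≤ Nat.multichoose (Fintype.card {p : Fin d × Fin d // p.1 ≤ p.2}) n) :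
    Real.log N ≤ ((d : ℝ) - 1) * ((d : ℝ) / 2 + 1) * Real.log ((n : ℝ) + 1) := by
  have hcard := two_mul_card_pairs d
  obtain hm | ⟨m, hm⟩ : Fintype.card {p : Fin d × Fin d // p.1 ≤ p.2} = 0 ∨
      ∃ m, Fintype.card {p : Fin d × Fin d // p.1 ≤ p.2} = m + 1 := by
    cases Fintype.card {p : Fin d × Fin d // p.1 ≤ p.2} <;> simp
  · rw [hm] at h
    cases n with
    | zero =>
      have : N = 1 := le_antisymm (by simpa using h) hN
      simp [this]
    | succ n =>
      rw [Nat.multichoose_zero_succ] at h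
      omega
  · rw [hm] at h hcard
    have hle : (N : ℝ) ≤ ((n : ℝ) + 1) ^ m := by
      exact_mod_cast h.trans (multichoose_succ_le_pow m n)
    have hmd : (m : ℝ) = ((d : ℝ) - 1) * ((d : ℝ) / 2 + 1) := by
      have : (2 : ℝ) * (m + 1) = d * (d + 1) := by exact_mod_cast hcard
      linarith
    rw [← hmd, ← Real.log_pow]
    exact Real.log_le_log (by exact_mod_cast hN) hle

end PermutationInvariants

section RelativeEntropyInequalities

open scoped Matrix

/-- Integrated form of a comparison of rational functions: if `∑ c a² / (b + s a) ≥ 0` for all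
`s > 0` and `∑ c a = 0`, then `∑ c a log b ≤ ∑ c a log a`. -/
lemma sum_mul_log_le_of_sum_div_nonneg {I : Type*} [Fintype I] {c a b : I → ℝ}
    (ha : ∀ i, 0 ≤ a i) (hb : ∀ i, 0 ≤ b i) (hab : ∀ i, b i = 0 → c i * a i = 0)
    (hsum : ∑ i, c i * a i = 0)
    (h : ∀ s : ℝ, 0 < s → 0 ≤ ∑ i, c i * a i ^ 2 / (b i + s * a i)) :
    ∑ i, c i * a i * Real.log (b i) ≤ ∑ i, c i * a i * Real.log (a i) := by
  have hcases : ∀ i, c i * a i = 0 ∨ (0 < a i ∧ 0 < b i) := by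
    intro i
    by_cases hi : c i * a i = 0
    · exact Or.inl hi
    · refine Or.inr ⟨(ha i).lt_of_ne fun h => hi (by rw [← h, mul_zero]),
        (hb i).lt_of_ne fun h => hi (hab i h.symm)⟩
  let F : ℝ → ℝ := fun s => ∑ i, c i * a i * Real.log (b i + s * a i)
  have hderiv : ∀ s, 0 ≤ s → HasDerivAt F (∑ i, c i * a i ^ 2 / (b i + s * a i)) s := by
    intro s hs
    refine HasDerivAt.fun_sum fun i _ => ?_
    rcases hcases i with hi | ⟨hai, hbi⟩
    · have : c i * a i ^ 2 = 0 := by rw [pow_two, ← mul_assoc, hi, zero_mul]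
      simpa only [hi, zero_mul, this, zero_div] using hasDerivAt_const s (0 : ℝ)
    · have hpos : 0 < b i + s * a i := by positivity
      refine HasDerivAt.congr_deriv (((((hasDerivAt_id' s).mul_const (a i)).const_add
        (b i)).log hpos.ne').const_mul (c i * a i)) ?_
      ring
  have hmono : MonotoneOn F (Set.Ici 0) := by
    refine monotoneOn_of_deriv_nonneg (convex_Ici 0)
      (fun s hs => (hderiv s hs).continuousAt.continuousWithinAt) ?_ ?_
    · intro s hs
      rw [interior_Ici] at hs
      exact (hderiv s (le_of_lt hs)).differentiableAt.differentiableWithinAt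
    · intro s hs
      rw [interior_Ici] at hs
      rw [(hderiv s (le_of_lt hs)).deriv]
      exact h s hs
  have hlim : Tendsto F atTop (𝓝 (∑ i, c i * a i * Real.log (a i))) := by
    have h1 : Tendsto (fun s : ℝ => ∑ i, c i * a i * Real.log (b i * s⁻¹ + a i)) atTop
        (𝓝 (∑ i, c i * a i * Real.log (a i))) := by
      refine tendsto_finsetSum _ fun i _ => ?_
      rcases hcases i with hi | ⟨hai, -⟩
      · simp [hi]
      · refine Tendsto.const_mul _ (Tendsto.log ?_ hai.ne')
        simpa using (tendsto_inv_atTop_zero.const_mul (b i)).add_const (a i)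
    refine h1.congr' ?_
    filter_upwards [eventually_gt_atTop 0] with s hs
    have h2 : F s = ∑ i, (c i * a i * Real.log (b i * s⁻¹ + a i) + c i * a i * Real.log s) := by
      refine Finset.sum_congr rfl fun i _ => ?_
      rcases hcases i with hi | ⟨hai, hbi⟩
      · simp [hi]
      · rw [← mul_add, ← Real.log_mul (by positivity) hs.ne']
        congr 2
        field_simp
    rw [h2, Finset.sum_add_distrib, ← Finset.sum_mul, hsum, zero_mul, add_zero]
  have h0 : F 0 = ∑ i, c i * a i * Real.log (b i) := by simp [F]
  rw [← h0]
  refine ge_of_tendsto hlim ?_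
  filter_upwards [eventually_ge_atTop 0] with s hs
  exact hmono (Set.mem_Ici.mpr le_rfl) hs hs

variable {κ : Type*} [Fintype κ] [DecidableEq κ]

lemma sum_normSq_col {Z : Matrix κ κ ℂ} (hZ : Zᴴ * Z = 1) (k : κ) :
    ∑ x, Complex.normSq (Z x k) = 1 := by
  have h := congrFun (congrFun hZ k) k
  rw [Matrix.mul_apply, Matrix.one_apply_eq] at h
  simp only [Matrix.conjTranspose_apply, Complex.star_def, ← Complex.normSq_eq_conj_mul_self] at h
  exact_mod_cast h

/-- Diagonal of a conjugated diagonal matrix. -/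
lemma conj_diagonal_apply_self (Z : Matrix κ κ ℂ) (r : κ → ℝ) (x : κ) :
    (Z * Matrix.diagonal (fun k => (r k : ℂ)) * Zᴴ) x x =
      ((∑ k, Complex.normSq (Z x k) * r k : ℝ) : ℂ) := by
  rw [Matrix.mul_apply]
  push_cast
  refine Finset.sum_congr rfl fun k _ => ?_
  rw [Matrix.mul_diagonal, Matrix.conjTranspose_apply, Complex.star_def,
    Complex.normSq_eq_conj_mul_self]
  ring

lemma trace_mul_conj_diagonal (ρ E : Matrix κ κ ℂ) (φ : κ → ℝ) :
    (ρ * (E * Matrix.diagonal (fun x => (φ x : ℂ)) * Eᴴ)).trace =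
      ∑ x, (Eᴴ * ρ * E) x x * (φ x : ℂ) := by
  rw [← mul_assoc, Matrix.trace_mul_comm, ← mul_assoc, ← mul_assoc, Matrix.trace]
  simp [Matrix.mul_diagonal]

lemma trace_mul_conj_diagonal_re (ρ E : Matrix κ κ ℂ) (φ : κ → ℝ) :
    (ρ * (E * Matrix.diagonal (fun x => (φ x : ℂ)) * Eᴴ)).trace.re =
      ∑ x, ((Eᴴ * ρ * E) x x).re * φ x := by
  rw [trace_mul_conj_diagonal, Complex.re_sum]
  exact Finset.sum_congr rfl fun x _ => Complex.re_mul_ofReal _ _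

lemma isHermitian_eq_conj_diagonal {A : Matrix κ κ ℂ} (hA : A.IsHermitian) :
    A = (hA.eigenvectorUnitary : Matrix κ κ ℂ) *
      Matrix.diagonal (fun i => (hA.eigenvalues i : ℂ)) *
      (hA.eigenvectorUnitary : Matrix κ κ ℂ)ᴴ := by
  conv_lhs => rw [hA.spectral_theorem, Unitary.conjStarAlgAut_apply]
  rfl

lemma matLog_eq_conj_diagonal {A : Matrix κ κ ℂ} (hA : A.IsHermitian) :
    matLog A = (hA.eigenvectorUnitary : Matrix κ κ ℂ) *
      Matrix.diagonal (fun i => (Real.log (hA.eigenvalues i) : ℂ)) *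
      (hA.eigenvectorUnitary : Matrix κ κ ℂ)ᴴ := by
  rw [matLog, dif_pos hA]
  rfl

lemma conjTranspose_mul_eigenvectorUnitary {A : Matrix κ κ ℂ} (hA : A.IsHermitian) :
    (hA.eigenvectorUnitary : Matrix κ κ ℂ)ᴴ * (hA.eigenvectorUnitary : Matrix κ κ ℂ) = 1 :=
  Unitary.coe_star_mul_self _

lemma trace_mul_nonneg_of_posSemidef_s16 {A B : Matrix κ κ ℂ} (hA : A.PosSemidef)
    (hB : B.PosSemidef) : 0 ≤ (A * B).trace.re := by
  rw [Matrix.trace_mul_comm]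
  conv_rhs => rw [isHermitian_eq_conj_diagonal hA.1]
  rw [trace_mul_conj_diagonal_re]
  refine Finset.sum_nonneg fun x _ => mul_nonneg ?_ (hA.eigenvalues_nonneg x)
  exact (Complex.nonneg_iff.mp (hB.conjTranspose_mul_mul_same _).diag_nonneg).1

/-- Operator Jensen inequality for the square of a POVM average, in trace form. -/
lemma trace_mul_sq_le_s16 {m : ℕ} {E : Fin m → Matrix κ κ ℂ} (hE : ∀ x, (E x).PosSemidef)
    (hsum : ∑ x, E x = 1) (g : Fin m → ℝ) {Φ : Matrix κ κ ℂ} (hΦ : Φ.PosSemidef) :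
    (Φ * ((∑ x, (g x : ℂ) • E x) * ∑ x, (g x : ℂ) • E x)).trace.re ≤
      ∑ x, g x ^ 2 * (Φ * E x).trace.re := by
  set G := ∑ x, (g x : ℂ) • E x with hG
  have hGh : Gᴴ = G := by
    rw [hG, Matrix.conjTranspose_sum]
    refine Finset.sum_congr rfl fun x _ => ?_
    rw [Matrix.conjTranspose_smul, (hE x).1, Complex.star_def, Complex.conj_ofReal]
  have hnonneg : ∀ x, 0 ≤ (Φ * (((g x : ℂ) • (1 : Matrix κ κ ℂ) - G) * E x *
      ((g x : ℂ) • (1 : Matrix κ κ ℂ) - G))).trace.re := by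
    intro x
    refine trace_mul_nonneg_of_posSemidef_s16 hΦ ?_
    have := (hE x).mul_mul_conjTranspose_same ((g x : ℂ) • (1 : Matrix κ κ ℂ) - G)
    rwa [Matrix.conjTranspose_sub, hGh, Matrix.conjTranspose_smul, Matrix.conjTranspose_one,
      Complex.star_def, Complex.conj_ofReal] at this
  have hid : ∑ x, ((g x : ℂ) • (1 : Matrix κ κ ℂ) - G) * E x *
      ((g x : ℂ) • (1 : Matrix κ κ ℂ) - G) = ∑ x, ((g x ^ 2 : ℝ) : ℂ) • E x - G * G := by
    have hterm : ∀ x, ((g x : ℂ) • (1 : Matrix κ κ ℂ) - G) * E x *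
      ((g x : ℂ) • (1 : Matrix κ κ ℂ) - G) = ((g x ^ 2 : ℝ) : ℂ) • E x - ((g x : ℂ) • E x) * G
        - G * ((g x : ℂ) • E x) + G * E x * G := by
      intro x
      simp only [sub_mul, mul_sub, smul_mul_assoc, mul_smul_comm, one_mul, mul_one, smul_sub,
        mul_assoc]
      push_cast
      rw [pow_two, mul_smul]
      abel
    simp only [hterm, Finset.sum_add_distrib, Finset.sum_sub_distrib, ← Finset.sum_mul,
      ← Finset.mul_sum, hsum, ← hG, mul_one]
    abel
  have := Finset.sum_nonneg fun x (_ : x ∈ Finset.univ) => hnonneg x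
  rw [← Complex.re_sum, ← Matrix.trace_sum, ← Finset.mul_sum, hid, mul_sub, Matrix.trace_sub,
    Complex.sub_re, sub_nonneg] at this
  refine this.trans_eq ?_
  rw [Finset.mul_sum, Matrix.trace_sum, Complex.re_sum]
  refine Finset.sum_congr rfl fun x _ => ?_
  rw [mul_smul_comm, Matrix.trace_smul, smul_eq_mul, Complex.re_ofReal_mul]

lemma sum_normSq_mul_row (h : Matrix κ κ ℂ) (q : κ → ℝ) :
    ∑ l, ∑ k, Complex.normSq (h l k) * q l =
      (hᴴ * Matrix.diagonal (fun l => (q l : ℂ)) * h).trace.re := by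
  rw [Finset.sum_comm, Matrix.trace, Complex.re_sum]
  refine Finset.sum_congr rfl fun k _ => ?_
  have := conj_diagonal_apply_self hᴴ q k
  rw [Matrix.conjTranspose_conjTranspose] at this
  simp [this]

lemma sum_normSq_mul_col (h : Matrix κ κ ℂ) (r : κ → ℝ) :
    ∑ l, ∑ k, Complex.normSq (h l k) * r k =
      (h * Matrix.diagonal (fun k => (r k : ℂ)) * hᴴ).trace.re := by
  rw [Matrix.trace, Complex.re_sum]
  refine Finset.sum_congr rfl fun k _ => ?_
  simp [conj_diagonal_apply_self]

lemma two_mul_sub_le_normSq_div (z h : ℂ) {r t : ℝ} (ht : 0 < t) :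
    2 * (star z * h).re * r - Complex.normSq h * t ≤ Complex.normSq z * r ^ 2 / t := by
  rw [le_div_iff₀ ht]
  simp only [Complex.normSq_apply, Complex.star_def, Complex.mul_re, Complex.conj_re,
    Complex.conj_im]
  nlinarith [sq_nonneg (z.re * r - h.re * t), sq_nonneg (z.im * r - h.im * t)]

/-- Monotonicity of the `χ²`-type quantities `∑ P² / (Q + s P)` under measurements. -/
lemma sum_sq_div_le {ρ σ : Matrix κ κ ℂ} (hρ : ρ.PosSemidef) (hσ : σ.PosSemidef)
    {m : ℕ} {E : Fin m → Matrix κ κ ℂ} (hE : ∀ x, (E x).PosSemidef) (hsum : ∑ x, E x = 1)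
    {s : ℝ} (hs : 0 < s) :
    ∑ x, (ρ * E x).trace.re ^ 2 / ((σ * E x).trace.re + s * (ρ * E x).trace.re) ≤
      ∑ l, ∑ k, Complex.normSq (((hσ.1.eigenvectorUnitary : Matrix κ κ ℂ)ᴴ *
        (hρ.1.eigenvectorUnitary : Matrix κ κ ℂ)) l k) * hρ.1.eigenvalues k ^ 2 /
        (hσ.1.eigenvalues l + s * hρ.1.eigenvalues k) := by
  set A := (hρ.1.eigenvectorUnitary : Matrix κ κ ℂ) with hA
  set B := (hσ.1.eigenvectorUnitary : Matrix κ κ ℂ) with hB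
  set r := hρ.1.eigenvalues with hr
  set q := hσ.1.eigenvalues with hq
  have hρd : ρ = A * Matrix.diagonal (fun i => (r i : ℂ)) * Aᴴ := isHermitian_eq_conj_diagonal hρ.1
  have hσd : σ = B * Matrix.diagonal (fun i => (q i : ℂ)) * Bᴴ := isHermitian_eq_conj_diagonal hσ.1
  have hAA : Aᴴ * A = 1 := conjTranspose_mul_eigenvectorUnitary hρ.1
  have hBB : Bᴴ * B = 1 := conjTranspose_mul_eigenvectorUnitary hσ.1
  have hAA' : A * Aᴴ = 1 := mul_eq_one_comm.mp hAA
  have hBB' : B * Bᴴ = 1 := mul_eq_one_comm.mp hBB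
  set P : Fin m → ℝ := fun x => (ρ * E x).trace.re with hP
  set Q : Fin m → ℝ := fun x => (σ * E x).trace.re with hQ
  have hP0 : ∀ x, 0 ≤ P x := fun x => trace_mul_nonneg_of_posSemidef_s16 hρ (hE x)
  have hQ0 : ∀ x, 0 ≤ Q x := fun x => trace_mul_nonneg_of_posSemidef_s16 hσ (hE x)
  set g : Fin m → ℝ := fun x => P x / (Q x + s * P x) with hg
  set G := ∑ x, (g x : ℂ) • E x with hG
  have hGh : Gᴴ = G := by
    rw [hG, Matrix.conjTranspose_sum]
    refine Finset.sum_congr rfl fun x _ => ?_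
    rw [Matrix.conjTranspose_smul, (hE x).1, Complex.star_def, Complex.conj_ofReal]
  set h := Bᴴ * G * A with hh
  set Z := Bᴴ * A with hZ
  have hlin : ∑ l, ∑ k, (star (Z l k) * h l k).re * r k = ∑ x, g x * P x := by
    have h1 : (ρ * G).trace = (Matrix.diagonal (fun k => (r k : ℂ)) * (Zᴴ * h)).trace := by
      rw [hh, hZ, Matrix.conjTranspose_mul, Matrix.conjTranspose_conjTranspose,
        show Aᴴ * B * (Bᴴ * G * A) = Aᴴ * (B * Bᴴ) * G * A by simp only [mul_assoc], hBB', mul_one]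
      rw [hρd, mul_assoc, mul_assoc, Matrix.trace_mul_comm]
      simp only [mul_assoc]
    have h2 : (ρ * G).trace.re = ∑ x, g x * P x := by
      rw [hG, Finset.mul_sum, Matrix.trace_sum, Complex.re_sum]
      refine Finset.sum_congr rfl fun x _ => ?_
      rw [mul_smul_comm, Matrix.trace_smul, smul_eq_mul, Complex.re_ofReal_mul]
    rw [← h2, h1, Matrix.trace, Complex.re_sum, Finset.sum_comm]
    refine Finset.sum_congr rfl fun k _ => ?_
    rw [Matrix.diag_apply, Matrix.diagonal_mul, Complex.re_ofReal_mul, Matrix.mul_apply,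
      Complex.re_sum, Finset.mul_sum]
    refine Finset.sum_congr rfl fun l _ => ?_
    rw [Matrix.conjTranspose_apply, mul_comm]
  have hquadq : ∑ l, ∑ k, Complex.normSq (h l k) * q l ≤ ∑ x, g x ^ 2 * Q x := by
    rw [sum_normSq_mul_row]
    refine le_trans (le_of_eq ?_) (trace_mul_sq_le_s16 hE hsum g hσ)
    rw [← hG, hh, Matrix.conjTranspose_mul, Matrix.conjTranspose_mul, hGh,
      Matrix.conjTranspose_conjTranspose,
      show Aᴴ * (G * B) * Matrix.diagonal (fun l => (q l : ℂ)) * (Bᴴ * G * A) =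
        Aᴴ * (G * (B * Matrix.diagonal (fun l => (q l : ℂ)) * Bᴴ) * G * A) by
        simp only [mul_assoc], ← hσd, Matrix.trace_mul_comm, mul_assoc, hAA', mul_one, mul_assoc,
      Matrix.trace_mul_comm, mul_assoc]
  have hquadr : ∑ l, ∑ k, Complex.normSq (h l k) * r k ≤ ∑ x, g x ^ 2 * P x := by
    rw [sum_normSq_mul_col]
    refine le_trans (le_of_eq ?_) (trace_mul_sq_le_s16 hE hsum g hρ)
    rw [← hG, hh, Matrix.conjTranspose_mul, Matrix.conjTranspose_mul, hGh,
      Matrix.conjTranspose_conjTranspose,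
      show Bᴴ * G * A * Matrix.diagonal (fun l => (r l : ℂ)) * (Aᴴ * (G * B)) =
        Bᴴ * (G * (A * Matrix.diagonal (fun l => (r l : ℂ)) * Aᴴ) * G * B) by
        simp only [mul_assoc], ← hρd, Matrix.trace_mul_comm, mul_assoc, hBB', mul_one, mul_assoc,
      Matrix.trace_mul_comm, mul_assoc]
  have hterm : ∀ l k, 2 * ((star (Z l k) * h l k).re * r k) -
      (Complex.normSq (h l k) * q l + s * (Complex.normSq (h l k) * r k)) ≤
      Complex.normSq (Z l k) * r k ^ 2 / (q l + s * r k) := by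
    intro l k
    have hql : 0 ≤ q l := hσ.eigenvalues_nonneg l
    have hrk : 0 ≤ r k := hρ.eigenvalues_nonneg k
    rcases (show 0 ≤ q l + s * r k by positivity).eq_or_lt with h0 | h0
    · have hr0 : r k = 0 := by nlinarith
      have hq0 : q l = 0 := by nlinarith
      simp [hr0, hq0]
    · have := two_mul_sub_le_normSq_div (Z l k) (h l k) (r := r k) h0
      linarith
  have hscal : ∀ x, P x ^ 2 / (Q x + s * P x) =
      2 * (g x * P x) - (g x ^ 2 * Q x + s * (g x ^ 2 * P x)) := by
    intro x
    simp only [hg]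
    rcases eq_or_ne (Q x + s * P x) 0 with h0 | h0
    · simp [h0]
    · field_simp
      ring
  calc ∑ x, P x ^ 2 / (Q x + s * P x)
      = 2 * ∑ x, g x * P x - (∑ x, g x ^ 2 * Q x + s * ∑ x, g x ^ 2 * P x) := by
        simp only [hscal, Finset.sum_sub_distrib, Finset.sum_add_distrib, Finset.mul_sum]
    _ ≤ 2 * ∑ l, ∑ k, (star (Z l k) * h l k).re * r k -
        (∑ l, ∑ k, Complex.normSq (h l k) * q l + s * ∑ l, ∑ k, Complex.normSq (h l k) * r k) := by
        rw [hlin]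
        have := mul_le_mul_of_nonneg_left hquadr hs.le
        linarith
    _ = ∑ l, ∑ k, (2 * ((star (Z l k) * h l k).re * r k) -
      (Complex.normSq (h l k) * q l + s * (Complex.normSq (h l k) * r k))) := by
        simp only [Finset.sum_sub_distrib, Finset.sum_add_distrib, Finset.mul_sum]
    _ ≤ _ := Finset.sum_le_sum fun l _ => Finset.sum_le_sum fun k _ => hterm l k

end RelativeEntropyInequalities

section MeasuredUpperBound

open scoped Matrix

variable {κ : Type*} [Fintype κ] [DecidableEq κ]

lemma exists_eq_mul_of_suppLE {ρ σ : Matrix κ κ ℂ} (h : suppLE ρ σ) :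
    ∃ C : Matrix κ κ ℂ, ρ = σ * C := by
  have hcol : ∀ j, ∃ v : κ → ℂ, σ *ᵥ v = ρ.col j := by
    intro j
    obtain ⟨v, hv⟩ := h ⟨Pi.single j 1, rfl⟩
    refine ⟨v, ?_⟩
    simpa only [Matrix.toLin'_apply, Matrix.mulVec_single_one] using hv
  choose v hv using hcol
  refine ⟨Matrix.of fun i j => v j i, ?_⟩
  ext i j
  exact (congrFun (hv j) i).symm

lemma suppLE_of_eq_mul {ρ σ C : Matrix κ κ ℂ} (h : ρ = σ * C) : suppLE ρ σ := by
  rw [suppLE, h, Matrix.toLin'_mul]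
  exact LinearMap.range_comp_le_range _ _

lemma sum_ereal_ne_bot {α : Type*} (S : Finset α) {f : α → EReal} (hf : ∀ x, f x ≠ ⊥) :
    ∑ x ∈ S, f x ≠ ⊥ := by
  induction S using Finset.cons_induction with
  | empty => simp
  | cons a S ha ih =>
    rw [Finset.sum_cons]
    exact EReal.add_ne_bot_iff.mpr ⟨hf a, ih⟩

lemma ereal_coe_sum {α : Type*} (S : Finset α) (f : α → ℝ) :
    ((∑ x ∈ S, f x : ℝ) : EReal) = ∑ x ∈ S, (f x : EReal) :=
  Finset.cons_induction (by simp) (fun a S ha ih => by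
    rw [Finset.sum_cons, Finset.sum_cons, EReal.coe_add, ih]) S

lemma clRelEnt_eq_coe {m : ℕ} {P Q : Fin m → ℝ} (h : ∀ x, Q x = 0 → P x = 0) :
    clRelEnt P Q = ((∑ x, P x * Real.log (P x / Q x) : ℝ) : EReal) := by
  rw [clRelEnt, ereal_coe_sum]
  refine Finset.sum_congr rfl fun x _ => ?_
  by_cases hP : P x = 0
  · simp [hP]
  · rw [if_neg hP, if_neg (mt (h x) hP)]

lemma clRelEnt_eq_top {m : ℕ} {P Q : Fin m → ℝ} {x : Fin m} (hP : P x ≠ 0) (hQ : Q x = 0) :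
    clRelEnt P Q = ⊤ := by
  rw [clRelEnt, ← Finset.add_sum_erase _ _ (Finset.mem_univ x), if_neg hP, if_pos hQ]
  refine EReal.top_add_of_ne_bot (sum_ereal_ne_bot _ fun y => ?_)
  split_ifs
  · exact EReal.zero_ne_bot
  · exact top_ne_bot
  · exact EReal.coe_ne_bot _

lemma conj_apply_self_re {ρ : Matrix κ κ ℂ} (hρ : ρ.IsHermitian) (E : Matrix κ κ ℂ) (x : κ) :
    ((Eᴴ * ρ * E) x x).re = ∑ k, Complex.normSq
      ((Eᴴ * (hρ.eigenvectorUnitary : Matrix κ κ ℂ)) x k) * hρ.eigenvalues k := by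
  have h : Eᴴ * ρ * E = Eᴴ * (hρ.eigenvectorUnitary : Matrix κ κ ℂ) *
      Matrix.diagonal (fun k => (hρ.eigenvalues k : ℂ)) *
      (Eᴴ * (hρ.eigenvectorUnitary : Matrix κ κ ℂ))ᴴ := by
    conv_lhs => rw [isHermitian_eq_conj_diagonal hρ]
    rw [Matrix.conjTranspose_mul, Matrix.conjTranspose_conjTranspose]
    simp only [mul_assoc]
  rw [h, conj_diagonal_apply_self, Complex.ofReal_re]

lemma trace_mul_matLog_sub_s16 {ρ σ : Matrix κ κ ℂ} (hρ : ρ.IsHermitian) {E : Matrix κ κ ℂ}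
    {lam : κ → ℝ} (hlog : matLog σ = E * Matrix.diagonal (fun x => (Real.log (lam x) : ℂ)) * Eᴴ) :
    (ρ * (matLog ρ - matLog σ)).trace.re =
      ∑ k, hρ.eigenvalues k * Real.log (hρ.eigenvalues k) -
        ∑ x, ((Eᴴ * ρ * E) x x).re * Real.log (lam x) := by
  have hU := conjTranspose_mul_eigenvectorUnitary hρ
  have hd : (hρ.eigenvectorUnitary : Matrix κ κ ℂ)ᴴ * ρ * (hρ.eigenvectorUnitary : Matrix κ κ ℂ) =
      Matrix.diagonal (fun i => (hρ.eigenvalues i : ℂ)) := by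
    have hX := isHermitian_eq_conj_diagonal hρ
    generalize (hρ.eigenvectorUnitary : Matrix κ κ ℂ) = U at *
    generalize hρ.eigenvalues = r at *
    rw [hX]
    simp only [← mul_assoc, hU, one_mul]
    rw [mul_assoc, hU, mul_one]
  rw [mul_sub, Matrix.trace_sub, Complex.sub_re, hlog, matLog_eq_conj_diagonal hρ,
    trace_mul_conj_diagonal_re, trace_mul_conj_diagonal_re, hd]
  simp

lemma sum_eigenvalues_eq_one {ρ : Matrix κ κ ℂ} (hρ : IsState ρ) :
    ∑ k, hρ.1.1.eigenvalues k = 1 := by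
  have h := hρ.1.1.trace_eq_sum_eigenvalues
  have h' := h.symm.trans hρ.2
  rw [← RCLike.ofReal_sum] at h'
  exact RCLike.ofReal_injective (K := ℂ) (h'.trans RCLike.ofReal_one.symm)

/-- The data-processing inequality for quantum-to-classical channels. -/
lemma measuredRelEnt_le_relEnt {ρ σ : Matrix κ κ ℂ} (hρ : IsState ρ) (hσ : IsState σ) :
    measuredRelEnt ρ σ ≤ relEnt ρ σ := by
  by_cases hsupp : suppLE ρ σ
  swap
  · rw [relEnt, if_neg hsupp]
    exact le_top
  rw [relEnt, if_pos hsupp, measuredRelEnt]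
  refine iSup_le fun m => iSup_le fun E => iSup_le fun hE => iSup_le fun hsum => ?_
  have hfund := fun s (hs : 0 < s) => sum_sq_div_le hρ.1 hσ.1 hE hsum (s := s) hs
  rw [trace_mul_matLog_sub_s16 hρ.1.1 (matLog_eq_conj_diagonal hσ.1.1)]
  simp only [conj_apply_self_re hρ.1.1]
  have hr1 := sum_eigenvalues_eq_one hρ
  have hr0 := hρ.1.eigenvalues_nonneg
  have hq0 := hσ.1.eigenvalues_nonneg
  have hAA := conjTranspose_mul_eigenvectorUnitary hρ.1.1
  have hBB := conjTranspose_mul_eigenvectorUnitary hσ.1.1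
  have hρd := isHermitian_eq_conj_diagonal hρ.1.1
  have hσd := isHermitian_eq_conj_diagonal hσ.1.1
  generalize (hρ.1.1.eigenvectorUnitary : Matrix κ κ ℂ) = A at *
  generalize (hσ.1.1.eigenvectorUnitary : Matrix κ κ ℂ) = B at *
  generalize hρ.1.1.eigenvalues = r at *
  generalize hσ.1.1.eigenvalues = q at *
  have hBB' : B * Bᴴ = 1 := mul_eq_one_comm.mp hBB
  set Z := Bᴴ * A with hZ
  have hZZ : Zᴴ * Z = 1 := by
    rw [hZ, Matrix.conjTranspose_mul, Matrix.conjTranspose_conjTranspose,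
      show Aᴴ * B * (Bᴴ * A) = Aᴴ * (B * Bᴴ) * A by simp only [mul_assoc], hBB', mul_one, hAA]
  have hw1 := sum_normSq_col hZZ
  have hvan : ∀ l k, q l = 0 → Complex.normSq (Z l k) * r k = 0 := by
    intro l k hl
    obtain ⟨C, hC⟩ := exists_eq_mul_of_suppLE hsupp
    have h1 : Z * Matrix.diagonal (fun k => (r k : ℂ)) =
        Matrix.diagonal (fun l => (q l : ℂ)) * (Bᴴ * C * A) := by
      calc Z * Matrix.diagonal (fun k => (r k : ℂ))
          = Bᴴ * (A * Matrix.diagonal (fun k => (r k : ℂ)) * Aᴴ) * A := by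
            simp only [hZ, mul_assoc, hAA, mul_one]
        _ = Bᴴ * (σ * C) * A := by rw [← hρd, hC]
        _ = (Bᴴ * B) * Matrix.diagonal (fun l => (q l : ℂ)) * Bᴴ * C * A := by
            rw [hσd]; simp only [mul_assoc]
        _ = _ := by rw [hBB, one_mul]; simp only [mul_assoc]
    have h2 := congrFun (congrFun h1 l) k
    rw [Matrix.mul_diagonal, Matrix.diagonal_mul, hl, Complex.ofReal_zero, zero_mul] at h2
    rcases mul_eq_zero.mp h2 with h | h
    · simp [h]
    · simp [Complex.ofReal_eq_zero.mp h]
  have hP0 : ∀ x, 0 ≤ (ρ * E x).trace.re := fun x => trace_mul_nonneg_of_posSemidef_s16 hρ.1 (hE x)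
  have hQ0 : ∀ x, 0 ≤ (σ * E x).trace.re := fun x => trace_mul_nonneg_of_posSemidef_s16 hσ.1 (hE x)
  have hP1 : ∑ x, (ρ * E x).trace.re = 1 := by
    rw [← Complex.re_sum, ← Matrix.trace_sum, ← Finset.mul_sum, hsum, mul_one, hρ.2, Complex.one_re]
  set P : Fin m → ℝ := fun x => (ρ * E x).trace.re with hP
  set Q : Fin m → ℝ := fun x => (σ * E x).trace.re with hQ
  have hac : ∀ x, Q x = 0 → P x = 0 := by
    intro x hx
    set K := ∑ l, ∑ k, Complex.normSq (Z l k) * r k ^ 2 / q l with hK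
    have hK0 : 0 ≤ K := Finset.sum_nonneg fun l _ => Finset.sum_nonneg fun k _ =>
      div_nonneg (mul_nonneg (Complex.normSq_nonneg _) (sq_nonneg _)) (hq0 l)
    have hbound : ∀ s : ℝ, 0 < s → P x ≤ s * K := by
      intro s hs
      have h1 : P x ^ 2 / (Q x + s * P x) ≤ K := by
        refine le_trans (Finset.single_le_sum (f := fun x => P x ^ 2 / (Q x + s * P x))
          (fun y _ => div_nonneg (sq_nonneg _)
            (add_nonneg (hQ0 y) (mul_nonneg hs.le (hP0 y)))) (Finset.mem_univ x)) ?_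
        refine (hfund s hs).trans (Finset.sum_le_sum fun l _ => Finset.sum_le_sum fun k _ => ?_)
        rcases (hq0 l).eq_or_lt with h | h
        · have := hvan l k h.symm
          rw [pow_two, ← mul_assoc, this, zero_mul, zero_div, zero_div]
        · exact div_le_div_of_nonneg_left (mul_nonneg (Complex.normSq_nonneg _) (sq_nonneg _)) h
            (le_add_of_nonneg_right (mul_nonneg hs.le (hr0 k)))
      rw [hx, zero_add] at h1
      rcases (hP0 x).eq_or_lt with h | h
      · have : P x = 0 := h.symm
        rw [this]
        positivity
      · have h2 : P x ^ 2 / (s * P x) = P x / s := by field_simp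
        rw [h2, div_le_iff₀ hs] at h1
        linarith
    refine le_antisymm ?_ (hP0 x)
    refine le_of_forall_pos_le_add fun ε hε => ?_
    have h := hbound (ε / (K + 1)) (by positivity)
    have : ε / (K + 1) * K ≤ ε := by
      rw [div_mul_eq_mul_div, div_le_iff₀ (by positivity)]
      nlinarith
    linarith
  rw [clRelEnt_eq_coe hac, EReal.coe_le_coe_iff]
  have hmain := sum_mul_log_le_of_sum_div_nonneg (I := (κ × κ) ⊕ Fin m)
    (c := Sum.elim (fun i => Complex.normSq (Z i.1 i.2)) fun _ => -1)
    (a := Sum.elim (fun i => r i.2) P) (b := Sum.elim (fun i => q i.1) Q)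
    (by rintro (i | x); exacts [hr0 i.2, hP0 x]) (by rintro (i | x); exacts [hq0 i.1, hQ0 x])
    (by
      rintro (i | x) h
      · exact hvan _ _ h
      · have : P x = 0 := hac x h
        simp [this])
    (by
      simp only [Fintype.sum_sum_type, Sum.elim_inl, Sum.elim_inr, Fintype.sum_prod_type]
      rw [Finset.sum_comm]
      simp [← Finset.sum_mul, hw1, hr1, hP1])
    (by
      intro s hs
      have := hfund s hs
      simp only [Fintype.sum_sum_type, Sum.elim_inl, Sum.elim_inr, Fintype.sum_prod_type]
      simp only [neg_mul, one_mul, neg_div, Finset.sum_neg_distrib]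
      linarith)
  simp only [Fintype.sum_sum_type, Sum.elim_inl, Sum.elim_inr, Fintype.sum_prod_type, neg_mul,
    one_mul, Finset.sum_neg_distrib] at hmain
  have hent : ∑ l, ∑ k, Complex.normSq (Z l k) * r k * Real.log (r k) =
      ∑ k, r k * Real.log (r k) := by
    rw [Finset.sum_comm]
    refine Finset.sum_congr rfl fun k _ => ?_
    simp only [mul_assoc]
    rw [← Finset.sum_mul, hw1, one_mul]
  have hdiv : ∑ x, P x * Real.log (P x / Q x) =
      ∑ x, P x * Real.log (P x) - ∑ x, P x * Real.log (Q x) := by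
    rw [← Finset.sum_sub_distrib]
    refine Finset.sum_congr rfl fun x _ => ?_
    by_cases h : P x = 0
    · simp [h]
    · rw [Real.log_div h (mt (hac x) h), mul_sub]
  simp only [Finset.sum_mul]
  linarith

end MeasuredUpperBound

section PinchingLowerBound

open scoped Matrix

lemma sum_eq_sum_fiber {κ R : Type*} [Fintype κ] [AddCommMonoid R] (lam : κ → ℝ) (s : ℝ) {f : κ → R}
    (hf : ∀ y, lam y ≠ s → f y = 0) : ∑ y, f y = ∑ y : {y // lam y = s}, f y := by
  rw [← Finset.sum_subset (Finset.filter_subset (fun y => lam y = s) Finset.univ)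
    fun y _ hy => hf y (by simpa using hy)]
  exact Finset.sum_subtype _ (by simp) _

variable {κ : Type*} [Fintype κ] [DecidableEq κ]

/-- A Hermitian matrix can be diagonalized blockwise on the level sets of a function `lam`. -/
lemma exists_unitary_fiberwise_diagonalizing {M : Matrix κ κ ℂ} (hM : M.IsHermitian)
    (lam : κ → ℝ) :
    ∃ W : Matrix κ κ ℂ, Wᴴ * W = 1 ∧ (∀ y x, lam y ≠ lam x → W y x = 0) ∧
      ∀ x y, x ≠ y → lam x = lam y → (Wᴴ * M * W) x y = 0 := by
  have hsub : ∀ s, (M.submatrix (Subtype.val : {x // lam x = s} → κ) Subtype.val).IsHermitian :=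
    fun s => hM.submatrix _
  let V : ∀ s, Matrix {x // lam x = s} {x // lam x = s} ℂ :=
    fun s => ((hsub s).eigenvectorUnitary : Matrix _ _ ℂ)
  have hV : ∀ s, (V s)ᴴ * V s = 1 := fun s => conjTranspose_mul_eigenvectorUnitary (hsub s)
  have hVM : ∀ s, (V s)ᴴ * M.submatrix Subtype.val Subtype.val * V s =
      Matrix.diagonal (fun i => ((hsub s).eigenvalues i : ℂ)) := by
    intro s
    have hX := isHermitian_eq_conj_diagonal (hsub s)
    calc (V s)ᴴ * M.submatrix Subtype.val Subtype.val * V s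
        = (V s)ᴴ * (V s * Matrix.diagonal (fun i => ((hsub s).eigenvalues i : ℂ)) * (V s)ᴴ) *
          V s := congrArg (fun X => (V s)ᴴ * X * V s) hX
      _ = ((V s)ᴴ * V s) * Matrix.diagonal (fun i => ((hsub s).eigenvalues i : ℂ)) *
          ((V s)ᴴ * V s) := by simp only [mul_assoc]
      _ = _ := by rw [hV, one_mul, mul_one]
  let W : Matrix κ κ ℂ := fun y x => if h : lam y = lam x then V (lam x) ⟨y, h⟩ ⟨x, rfl⟩ else 0
  have hWV : ∀ s (y x : {x // lam x = s}), W y x = V s y x := by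
    rintro s ⟨y, hy⟩ ⟨x, rfl⟩
    exact dif_pos hy
  have hW0 : ∀ y x, lam y ≠ lam x → W y x = 0 := fun y x h => dif_neg h
  refine ⟨W, ?_, hW0, ?_⟩
  · ext x y
    rw [Matrix.mul_apply]
    simp only [Matrix.conjTranspose_apply]
    by_cases hxy : lam y = lam x
    · rw [sum_eq_sum_fiber lam (lam x) fun z hz => by rw [hW0 z x hz, star_zero, zero_mul]]
      have h := congrFun (congrFun (hV (lam x)) ⟨x, rfl⟩) ⟨y, hxy⟩
      rw [Matrix.mul_apply] at h
      simp only [Matrix.conjTranspose_apply, ← hWV] at h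
      rw [h]
      simp only [Matrix.one_apply, Subtype.mk.injEq]
    · rw [Matrix.one_apply_ne (fun h => hxy (congrArg lam h.symm))]
      refine Finset.sum_eq_zero fun z _ => ?_
      by_cases hz : lam z = lam x
      · rw [hW0 z y (fun h => hxy (h.symm.trans hz)), mul_zero]
      · rw [hW0 z x hz, star_zero, zero_mul]
  · intro x y hne hxy
    have h := congrFun (congrFun (hVM (lam x)) ⟨x, rfl⟩) ⟨y, hxy.symm⟩
    rw [Matrix.diagonal_apply_ne _ (fun h => hne (congrArg Subtype.val h)), Matrix.mul_apply] at h
    simp only [Matrix.mul_apply, Matrix.conjTranspose_apply, Matrix.submatrix_apply, ← hWV] at h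
    rw [Matrix.mul_apply, sum_eq_sum_fiber lam (lam x)
      fun z hz => by rw [hW0 z y (fun h => hz (h.trans hxy.symm)), mul_zero]]
    refine Eq.trans (Finset.sum_congr rfl fun z _ => ?_) h
    congr 1
    rw [Matrix.mul_apply]
    simp only [Matrix.conjTranspose_apply]
    exact sum_eq_sum_fiber lam (lam x) fun z hz => by rw [hW0 z x hz, star_zero, zero_mul]

/-- A scalar form of the pinching inequality on one spectral block. -/
lemma mul_sum_normSq_div_le_one {Z M : Matrix κ κ ℂ} {r p : κ → ℝ} (hr : ∀ k, 0 ≤ r k)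
    (hM : M = Z * Matrix.diagonal (fun k => (r k : ℂ)) * Zᴴ) (hp : ∀ x, M x x = (p x : ℂ))
    (hp0 : ∀ x, 0 ≤ p x) {S : Finset κ} (hS : ∀ x ∈ S, ∀ y ∈ S, x ≠ y → M x y = 0) (k : κ) :
    r k * ∑ x ∈ S, Complex.normSq (Z x k) / p x ≤ 1 := by
  set c := ∑ x ∈ S, Complex.normSq (Z x k) / p x with hc
  have hc0 : 0 ≤ c := Finset.sum_nonneg fun x _ => div_nonneg (Complex.normSq_nonneg _) (hp0 x)
  let t : κ → ℂ := fun j => ∑ x ∈ S, star (Z x k / p x) * Z x j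
  have htk : t k = (c : ℂ) := by
    rw [hc]
    push_cast
    refine Finset.sum_congr rfl fun x _ => ?_
    rw [Complex.star_def, map_div₀, Complex.conj_ofReal, Complex.normSq_eq_conj_mul_self]
    ring
  have hMxy : ∀ x y, M x y = ∑ j, (r j : ℂ) * (Z x j * star (Z y j)) := by
    intro x y
    rw [hM, Matrix.mul_apply]
    refine Finset.sum_congr rfl fun j _ => ?_
    rw [Matrix.mul_diagonal, Matrix.conjTranspose_apply]
    ring
  have hquad : ∑ j, r j * Complex.normSq (t j) = c := by
    have h : ((∑ j, r j * Complex.normSq (t j) : ℝ) : ℂ) =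
        ∑ x ∈ S, ∑ y ∈ S, star (Z x k / p x) * (Z y k / p y) * M x y := by
      push_cast
      have hj : ∀ j, (r j : ℂ) * (Complex.normSq (t j) : ℂ) = ∑ x ∈ S, ∑ y ∈ S,
          star (Z x k / p x) * (Z y k / p y) * ((r j : ℂ) * (Z x j * star (Z y j))) := by
        intro j
        rw [← Complex.mul_conj, ← Complex.star_def, star_sum, Finset.sum_mul_sum, Finset.mul_sum]
        refine Finset.sum_congr rfl fun x _ => ?_
        rw [Finset.mul_sum]
        refine Finset.sum_congr rfl fun y _ => ?_
        rw [star_mul', star_star]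
        ring
      simp only [hj]
      rw [Finset.sum_comm]
      refine Finset.sum_congr rfl fun x _ => ?_
      rw [Finset.sum_comm]
      refine Finset.sum_congr rfl fun y _ => ?_
      rw [hMxy, Finset.mul_sum]
    have h2 : ∑ x ∈ S, ∑ y ∈ S, star (Z x k / p x) * (Z y k / p y) * M x y = (c : ℂ) := by
      rw [hc]
      push_cast
      refine Finset.sum_congr rfl fun x hx => ?_
      rw [Finset.sum_eq_single_of_mem x hx fun y hy hne => by
        rw [hS x hx y hy hne.symm, mul_zero], hp, Complex.star_def, map_div₀, Complex.conj_ofReal,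
        Complex.normSq_eq_conj_mul_self]
      by_cases h0 : (p x : ℂ) = 0
      · simp [h0]
      · field_simp
    exact_mod_cast h.trans h2
  have hle : r k * c ^ 2 ≤ c := by
    have h := Finset.single_le_sum (f := fun j => r j * Complex.normSq (t j))
      (fun j _ => mul_nonneg (hr j) (Complex.normSq_nonneg _)) (Finset.mem_univ k)
    rw [hquad] at h
    simpa only [htk, Complex.normSq_ofReal, ← pow_two] using h
  rcases hc0.eq_or_lt with h | h
  · rw [← h, mul_zero]
    exact zero_le_one
  · nlinarith

/-- Blockwise dephasing with `N` blocks increases the entropy by at most `log N`. -/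
lemma sum_mul_log_le_add_log_card {Z M : Matrix κ κ ℂ} {r p : κ → ℝ} (hZ : Zᴴ * Z = 1)
    (hr : ∀ k, 0 ≤ r k) (hr1 : ∑ k, r k = 1)
    (hM : M = Z * Matrix.diagonal (fun k => (r k : ℂ)) * Zᴴ)
    (hp : ∀ x, p x = ∑ k, Complex.normSq (Z x k) * r k)
    (lam : κ → ℝ) (hoff : ∀ x y, x ≠ y → lam x = lam y → M x y = 0) :
    ∑ k, r k * Real.log (r k) ≤
      ∑ x, p x * Real.log (p x) + Real.log (Finset.univ.image lam).card := by
  set N := ((Finset.univ.image lam).card : ℝ) with hN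
  have hκ : Nonempty κ := by
    by_contra h
    rw [not_nonempty_iff] at h
    simp at hr1
  have hN0 : 0 < N := by
    rw [hN]
    exact_mod_cast Finset.card_pos.mpr (Finset.univ_nonempty.image lam)
  have hpM : ∀ x, M x x = (p x : ℂ) := fun x => by rw [hM, conj_diagonal_apply_self, hp]
  have hwr : ∀ x k, 0 ≤ Complex.normSq (Z x k) * r k := fun x k =>
    mul_nonneg (Complex.normSq_nonneg _) (hr k)
  have hp0 : ∀ x, 0 ≤ p x := fun x => by
    rw [hp]
    exact Finset.sum_nonneg fun k _ => hwr x k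
  have hw1 := sum_normSq_col hZ
  have hblocks : ∀ k, r k * ∑ x, Complex.normSq (Z x k) / p x ≤ N := by
    intro k
    rw [← Finset.sum_fiberwise_of_maps_to (s := Finset.univ) (t := Finset.univ.image lam)
      (g := lam) (fun x _ => Finset.mem_image_of_mem _ (Finset.mem_univ x)), Finset.mul_sum, hN,
      ← nsmul_one]
    refine Finset.sum_le_card_nsmul _ _ _ fun s _ => ?_
    refine mul_sum_normSq_div_le_one hr hM hpM hp0 (fun x hx y hy hne => hoff x y hne ?_) k
    rw [(Finset.mem_filter.mp hx).2, (Finset.mem_filter.mp hy).2]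
  have hpt : ∀ x k, Complex.normSq (Z x k) * r k * (Real.log (r k) - Real.log (p x)) ≤
      r k * (r k * (Complex.normSq (Z x k) / p x)) / N +
        Complex.normSq (Z x k) * r k * (Real.log N - 1) := by
    intro x k
    rcases (hwr x k).eq_or_lt with h | h
    · rw [← h, zero_mul, zero_mul, add_zero]
      exact div_nonneg (mul_nonneg (hr k) (mul_nonneg (hr k)
        (div_nonneg (Complex.normSq_nonneg _) (hp0 x)))) hN0.le
    · have hrk : 0 < r k := pos_of_mul_pos_right h (Complex.normSq_nonneg _)
      have hpx : 0 < p x := by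
        rw [hp]
        exact h.trans_le (Finset.single_le_sum (f := fun k => Complex.normSq (Z x k) * r k)
          (fun k _ => hwr x k) (Finset.mem_univ k))
      have hlog := Real.log_le_sub_one_of_pos (show 0 < r k / (p x * N) by positivity)
      rw [Real.log_div hrk.ne' (by positivity), Real.log_mul hpx.ne' hN0.ne'] at hlog
      have h2 := mul_le_mul_of_nonneg_left hlog h.le
      have h3 : Complex.normSq (Z x k) * r k * (r k / (p x * N)) =
          r k * (r k * (Complex.normSq (Z x k) / p x)) / N := by field_simp
      rw [← h3]
      linarith
  have hsum := Finset.sum_le_sum fun k (_ : k ∈ Finset.univ) =>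
    Finset.sum_le_sum fun x (_ : x ∈ Finset.univ) => hpt x k
  have hleft : ∑ k, ∑ x, Complex.normSq (Z x k) * r k * (Real.log (r k) - Real.log (p x)) =
      ∑ k, r k * Real.log (r k) - ∑ x, p x * Real.log (p x) := by
    simp only [mul_sub, Finset.sum_sub_distrib]
    congr 1
    · refine Finset.sum_congr rfl fun k _ => ?_
      simp only [mul_assoc]
      rw [← Finset.sum_mul, hw1, one_mul]
    · rw [Finset.sum_comm]
      refine Finset.sum_congr rfl fun x _ => ?_
      rw [← Finset.sum_mul, ← hp]
  have hright : ∑ k, ∑ x, (r k * (r k * (Complex.normSq (Z x k) / p x)) / N +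
        Complex.normSq (Z x k) * r k * (Real.log N - 1)) =
      ∑ k, r k * (r k * ∑ x, Complex.normSq (Z x k) / p x) / N + (Real.log N - 1) := by
    simp only [Finset.sum_add_distrib]
    congr 1
    · refine Finset.sum_congr rfl fun k _ => ?_
      rw [← Finset.sum_div, ← Finset.mul_sum, ← Finset.mul_sum]
    · simp only [← Finset.sum_mul, hw1, one_mul, hr1]
  have hle : ∑ k, r k * (r k * ∑ x, Complex.normSq (Z x k) / p x) / N ≤ 1 := by
    rw [← hr1]
    refine Finset.sum_le_sum fun k _ => ?_
    rw [div_le_iff₀ hN0]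
    exact mul_le_mul_of_nonneg_left (hblocks k) (hr k)
  rw [hleft, hright] at hsum
  linarith

/-- Measuring in an orthonormal basis, given by the columns of a unitary matrix. -/
lemma clRelEnt_le_measuredRelEnt_of_basis {m : ℕ} (e : Fin m ≃ κ) (ρ σ : Matrix κ κ ℂ)
    {E : Matrix κ κ ℂ} (hE : Eᴴ * E = 1) :
    clRelEnt (fun x => ((Eᴴ * ρ * E) (e x) (e x)).re) (fun x => ((Eᴴ * σ * E) (e x) (e x)).re) ≤
      measuredRelEnt ρ σ := by
  let F : Fin m → Matrix κ κ ℂ := fun x =>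
    E * Matrix.diagonal (fun y => ((if y = e x then 1 else 0 : ℝ) : ℂ)) * Eᴴ
  have hF : ∀ x, (F x).PosSemidef := by
    intro x
    refine Matrix.PosSemidef.mul_mul_conjTranspose_same
      (Matrix.PosSemidef.diagonal fun y => ?_) E
    dsimp only
    split_ifs <;> simp
  have hsum : ∑ x, F x = 1 := by
    have hone : ∑ x, Matrix.diagonal (fun y => ((if y = e x then 1 else 0 : ℝ) : ℂ)) =
        (1 : Matrix κ κ ℂ) := by
      rw [e.sum_comp fun z => Matrix.diagonal (fun y => ((if y = z then 1 else 0 : ℝ) : ℂ))]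
      ext x y
      rw [Matrix.sum_apply]
      by_cases h : x = y
      · subst h
        simp [apply_ite Complex.ofReal]
      · simp [h]
    rw [← Finset.sum_mul, ← Finset.mul_sum, hone, mul_one, mul_eq_one_comm.mp hE]
  have htr : ∀ (τ : Matrix κ κ ℂ) x, (τ * F x).trace.re = ((Eᴴ * τ * E) (e x) (e x)).re := by
    intro τ x
    simp only [F]
    rw [trace_mul_conj_diagonal_re]
    simp
  simp only [← htr]
  exact le_iSup_of_le m (le_iSup_of_le F (le_iSup_of_le hF (le_iSup_of_le hsum le_rfl)))

/-- The spectral pinching inequality for the measured relative entropy. -/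
lemma relEnt_le_measuredRelEnt_add_log_card {ρ σ : Matrix κ κ ℂ} (hρ : IsState ρ)
    (hσ : σ.IsHermitian) :
    relEnt ρ σ ≤ measuredRelEnt ρ σ +
      ((Real.log (Finset.univ.image hσ.eigenvalues).card : ℝ) : EReal) := by
  have hr1 := sum_eigenvalues_eq_one hρ
  have hr0 := hρ.1.eigenvalues_nonneg
  have hAA := conjTranspose_mul_eigenvectorUnitary hρ.1.1
  have hUU := conjTranspose_mul_eigenvectorUnitary hσ
  have hρd := isHermitian_eq_conj_diagonal hρ.1.1
  have hσd := isHermitian_eq_conj_diagonal hσ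
  have hlogd := matLog_eq_conj_diagonal hσ
  have hpE := conj_apply_self_re hρ.1.1
  have htr := fun E hlog => trace_mul_matLog_sub_s16 (σ := σ) hρ.1.1 (E := E)
    (lam := hσ.eigenvalues) hlog
  generalize (hρ.1.1.eigenvectorUnitary : Matrix κ κ ℂ) = A at *
  generalize (hσ.eigenvectorUnitary : Matrix κ κ ℂ) = U at *
  generalize hρ.1.1.eigenvalues = r at *
  generalize hσ.eigenvalues = lam at *
  have hUU' : U * Uᴴ = 1 := mul_eq_one_comm.mp hUU
  obtain ⟨W, hWW, hW0, hoff⟩ := exists_unitary_fiberwise_diagonalizing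
    (M := Uᴴ * ρ * U) (Matrix.isHermitian_conjTranspose_mul_mul U hρ.1.1) lam
  have hWW' : W * Wᴴ = 1 := mul_eq_one_comm.mp hWW
  obtain ⟨E, hE⟩ : ∃ E, E = U * W := ⟨_, rfl⟩
  have hEE : Eᴴ * E = 1 := by
    rw [hE, Matrix.conjTranspose_mul, show Wᴴ * Uᴴ * (U * W) = Wᴴ * (Uᴴ * U) * W by
      simp only [mul_assoc], hUU, mul_one, hWW]
  have hEE' : E * Eᴴ = 1 := mul_eq_one_comm.mp hEE
  have hfun : ∀ φ : ℝ → ℝ, U * Matrix.diagonal (fun x => (φ (lam x) : ℂ)) * Uᴴ =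
      E * Matrix.diagonal (fun x => (φ (lam x) : ℂ)) * Eᴴ := by
    intro φ
    have hcomm : Matrix.diagonal (fun x => (φ (lam x) : ℂ)) * W =
        W * Matrix.diagonal (fun x => (φ (lam x) : ℂ)) := by
      ext x y
      rw [Matrix.diagonal_mul, Matrix.mul_diagonal]
      by_cases h : lam x = lam y
      · rw [h, mul_comm]
      · rw [hW0 x y h, mul_zero, zero_mul]
    rw [hE, Matrix.conjTranspose_mul, mul_assoc U W, ← hcomm,
      show U * (Matrix.diagonal (fun x => (φ (lam x) : ℂ)) * W) * (Wᴴ * Uᴴ) =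
        U * Matrix.diagonal (fun x => (φ (lam x) : ℂ)) * (W * Wᴴ) * Uᴴ by simp only [mul_assoc],
      hWW', mul_one]
  have hσE : σ = E * Matrix.diagonal (fun x => (lam x : ℂ)) * Eᴴ := hσd.trans (hfun id)
  have hEσ : ∀ x, ((Eᴴ * σ * E) x x).re = lam x := by
    intro x
    rw [hσE, show Eᴴ * (E * Matrix.diagonal (fun x => (lam x : ℂ)) * Eᴴ) * E =
      (Eᴴ * E) * Matrix.diagonal (fun x => (lam x : ℂ)) * (Eᴴ * E) by simp only [mul_assoc], hEE]
    simp
  set Z := Eᴴ * A with hZ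
  have hZZ : Zᴴ * Z = 1 := by
    rw [hZ, Matrix.conjTranspose_mul, Matrix.conjTranspose_conjTranspose,
      show Aᴴ * E * (Eᴴ * A) = Aᴴ * (E * Eᴴ) * A by simp only [mul_assoc], hEE', mul_one, hAA]
  have hEρ : Eᴴ * ρ * E = Z * Matrix.diagonal (fun k => (r k : ℂ)) * Zᴴ := by
    rw [hρd, hZ, Matrix.conjTranspose_mul, Matrix.conjTranspose_conjTranspose]
    simp only [mul_assoc]
  replace hoff : ∀ x y, x ≠ y → lam x = lam y → (Eᴴ * ρ * E) x y = 0 := by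
    intro x y hne hxy
    rw [← hoff x y hne hxy, hE, Matrix.conjTranspose_mul]
    simp only [mul_assoc]
  have hp : ∀ x, ((Eᴴ * ρ * E) x x).re = ∑ k, Complex.normSq (Z x k) * r k := hpE E
  have hmeas := clRelEnt_le_measuredRelEnt_of_basis (Fintype.equivFin κ).symm ρ σ hEE
  simp only [hEσ] at hmeas
  have hent := sum_mul_log_le_add_log_card hZZ hr0 hr1 hEρ hp lam hoff
  set p : κ → ℝ := fun x => ((Eᴴ * ρ * E) x x).re
  by_cases hx : ∃ x, p x ≠ 0 ∧ lam x = 0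
  · obtain ⟨x, hpx, hlx⟩ := hx
    rw [clRelEnt_eq_top (x := Fintype.equivFin κ x) (by simpa using hpx) (by simpa using hlx),
      top_le_iff] at hmeas
    rw [hmeas, EReal.top_add_coe]
    exact le_top
  have hac : ∀ x, lam x = 0 → p x = 0 := fun x h => by
    by_contra hne
    exact hx ⟨x, hne, h⟩
  have hsupp : suppLE ρ σ := by
    have hZr : Z * Matrix.diagonal (fun k => (r k : ℂ)) =
        Matrix.diagonal (fun x => (lam x : ℂ)) * (Matrix.diagonal (fun x => (lam x : ℂ)⁻¹) *
          (Z * Matrix.diagonal (fun k => (r k : ℂ)))) := by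
      ext x k
      rw [Matrix.diagonal_mul, Matrix.diagonal_mul, Matrix.mul_diagonal]
      by_cases h : lam x = 0
      · have h0 := (hp x).symm.trans (hac x h)
        rw [Finset.sum_eq_zero_iff_of_nonneg
          fun k _ => mul_nonneg (Complex.normSq_nonneg _) (hr0 k)] at h0
        rcases mul_eq_zero.mp (h0 k (Finset.mem_univ k)) with hz | hz
        · rw [Complex.normSq_eq_zero.mp hz, zero_mul, mul_zero, mul_zero]
        · rw [hz, Complex.ofReal_zero, mul_zero, mul_zero, mul_zero]
      · rw [mul_inv_cancel_left₀ (Complex.ofReal_ne_zero.mpr h)]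
    refine suppLE_of_eq_mul (C := E * (Matrix.diagonal (fun x => (lam x : ℂ)⁻¹) *
      (Z * Matrix.diagonal (fun k => (r k : ℂ)))) * Zᴴ * Eᴴ) ?_
    calc ρ = (E * Eᴴ) * ρ * (E * Eᴴ) := by rw [hEE', one_mul, mul_one]
      _ = E * (Eᴴ * ρ * E) * Eᴴ := by simp only [mul_assoc]
      _ = E * (Matrix.diagonal (fun x => (lam x : ℂ)) * (Matrix.diagonal (fun x => (lam x : ℂ)⁻¹) *
          (Z * Matrix.diagonal (fun k => (r k : ℂ))))) * Zᴴ * Eᴴ := by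
        rw [hEρ, ← hZr]; simp only [mul_assoc]
      _ = E * Matrix.diagonal (fun x => (lam x : ℂ)) * (Eᴴ * E) *
          (Matrix.diagonal (fun x => (lam x : ℂ)⁻¹) *
          (Z * Matrix.diagonal (fun k => (r k : ℂ)))) * Zᴴ * Eᴴ := by
        rw [hEE, mul_one]; simp only [mul_assoc]
      _ = σ * _ := by
        rw [hσE]; simp only [mul_assoc]
  rw [relEnt, if_pos hsupp, htr E (hlogd.trans (hfun Real.log))]
  refine le_trans ?_ (add_le_add hmeas le_rfl)
  rw [clRelEnt_eq_coe fun x h => hac _ h, ← EReal.coe_add, EReal.coe_le_coe_iff,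
    (Fintype.equivFin κ).symm.sum_comp fun x => p x * Real.log (p x / lam x)]
  have hdiv : ∑ x, p x * Real.log (p x / lam x) =
      ∑ x, p x * Real.log (p x) - ∑ x, p x * Real.log (lam x) := by
    rw [← Finset.sum_sub_distrib]
    refine Finset.sum_congr rfl fun x _ => ?_
    by_cases h : p x = 0
    · simp [h]
    · rw [Real.log_div h (mt (hac x) h), mul_sub]
  rw [hdiv]
  linarith

end PinchingLowerBound

/-- **Asymptotic spectral pinching bound with explicit constants:**
`D(ρ_n‖σ_n) − (d−1)(d/2+1) log(n+1) ≤ D^ALL(ρ_n‖σ_n) ≤ D(ρ_n‖σ_n)` for permutation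
invariant `σ_n`. -/
theorem pinching_bound (d n : ℕ)
    (ρn σn : MatN (Fin d) n)
    (hρ : IsState ρn) (hσ : IsState σn)
    (hσ_perm : ∀ π : Equiv.Perm (Fin n), permCopies π σn = σn) :
    measuredRelEnt ρn σn ≤ relEnt ρn σn ∧
    relEnt ρn σn ≤ measuredRelEnt ρn σn +
      ((((d : ℝ) - 1) * ((d : ℝ) / 2 + 1) * Real.log ((n : ℝ) + 1) : ℝ) : EReal) := by
  refine ⟨measuredRelEnt_le_relEnt hρ hσ, ?_⟩
  refine (relEnt_le_measuredRelEnt_add_log_card hρ hσ.1.1).trans (add_le_add le_rfl ?_)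
  rw [EReal.coe_le_coe_iff]
  have hmem : σn ∈ permInvariant (Fin d) n := fun π i j =>
    congrFun (congrFun (hσ_perm π) i) j
  have hne : Nonempty (Fin n → Fin d) := by
    by_contra h
    rw [not_nonempty_iff] at h
    simpa [Matrix.trace] using hσ.2
  refine log_card_le_of_le_multichoose
    (Finset.card_pos.mpr (Finset.univ_nonempty.image _)) ?_
  rw [← Finset.card_image_of_injective _ Complex.ofReal_injective]
  refine card_eigenvalues_le_multichoose hmem _ fun s hs => ?_
  simp only [Finset.mem_image, Finset.mem_univ, true_and, exists_exists_eq_and] at hs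
  obtain ⟨i, rfl⟩ := hs
  refine ⟨hσ.1.1.eigenvectorBasis i, fun h => ?_, hσ.1.1.mulVec_eigenvectorBasis i⟩
  exact hσ.1.1.eigenvectorBasis.orthonormal.ne_zero i (PiLp.ext fun x => congrFun h x)

end QSanov
end
end
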